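/- arXiv:2403.07787 — 10 statements merged into one kernel-verified Lean document; each statement's English description precedes it below -/
import Mathlib

section
/- Let M ∈ ℕ and set θ_k = kπ/(2M+1), η_k = tan θ_k for k = 1,…,M, b₀ = 2M+1, and b_k = 2η_k²(1+η_k²)/(2M+1). Then for every real a > 0, the rational function R_M(z) = b₀ − Σ_{k=1}^{M} b_k/(z + η_k²) satisfies the closed-form identity R_M(a²) = a · ((a+1)^{2M+1} − (a−1)^{2M+1}) / ((a+1)^{2M+1} + (a−1)^{2M+1}). -/
open Real Finset

/-- The even and odd parts of `(z + 1) ^ (2 * m + 1)`, as polynomials in `z ^ 2`. -/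
theorem exists_even_odd_parts (m : ℕ) : ∃ A B : Polynomial ℝ,
    (∀ z : ℂ, (z + 1) ^ (2 * m + 1) =
      Polynomial.aeval (z ^ 2) A + z * Polynomial.aeval (z ^ 2) B) ∧
    A.natDegree ≤ m ∧ A.coeff m = 2 * m + 1 ∧ B.natDegree ≤ m ∧ B.coeff m = 1 ∧
    (Polynomial.X * B).coeff m = (m : ℝ) * (2 * m + 1) := by
  induction m with
  | zero => exact ⟨1, 1, by simp [add_comm]⟩
  | succ m ih =>
    obtain ⟨A, B, h, hA, hA', hB, hB', hB''⟩ := ih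
    have hAz : A.coeff (m + 1) = 0 := Polynomial.coeff_eq_zero_of_natDegree_lt (by omega)
    have hBz : B.coeff (m + 1) = 0 := Polynomial.coeff_eq_zero_of_natDegree_lt (by omega)
    refine ⟨Polynomial.X * A + A + Polynomial.C 2 * (Polynomial.X * B),
      Polynomial.X * B + B + Polynomial.C 2 * A, fun z ↦ ?_, ?_, ?_, ?_, ?_, ?_⟩
    · rw [show 2 * (m + 1) + 1 = 2 * m + 1 + 2 by ring, pow_add, h]
      simp only [map_add, map_mul, Polynomial.aeval_X, map_ofNat]
      ring
    · compute_degree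
      omega
    · simp only [Polynomial.coeff_add, Polynomial.coeff_C_mul, Polynomial.coeff_X_mul, hA', hB',
        hAz]
      push_cast; ring
    · compute_degree
      omega
    · simp only [Polynomial.coeff_add, Polynomial.coeff_C_mul, Polynomial.coeff_X_mul, hB', hAz,
        hBz]
      ring
    · rw [Polynomial.coeff_X_mul]
      simp only [Polynomial.coeff_add, Polynomial.coeff_C_mul, hB', hA', hB'']
      push_cast; ring

theorem angle_pos_and_lt_pi_div_two {M k : ℕ} (hk : k ∈ Finset.Icc 1 M) :
    0 < (k : ℝ) * π / (2 * (M : ℝ) + 1) ∧ (k : ℝ) * π / (2 * (M : ℝ) + 1) < π / 2 := by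
  obtain ⟨h1, h2⟩ := Finset.mem_Icc.mp hk
  have h1' : (1 : ℝ) ≤ k := by exact_mod_cast h1
  have h2' : (k : ℝ) ≤ M := by exact_mod_cast h2
  refine ⟨by positivity, ?_⟩
  rw [div_lt_div_iff₀ (by positivity) two_pos]
  nlinarith [pi_pos]

theorem tan_sq_injOn (M : ℕ) : Set.InjOn
    (fun k : ℕ ↦ -Real.tan ((k : ℝ) * π / (2 * (M : ℝ) + 1)) ^ 2) (Finset.Icc 1 M) := by
  intro j hj k hk h
  have hj' := angle_pos_and_lt_pi_div_two hj
  have hk' := angle_pos_and_lt_pi_div_two hk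
  have h1 := (pow_left_inj₀ (tan_pos_of_pos_of_lt_pi_div_two hj'.1 hj'.2).le
    (tan_pos_of_pos_of_lt_pi_div_two hk'.1 hk'.2).le two_ne_zero).mp (neg_injective h)
  have h2 := injOn_tan ⟨by linarith [pi_pos], hj'.2⟩ ⟨by linarith [pi_pos], hk'.2⟩ h1
  have h3 : (2 * (M : ℝ) + 1) ≠ 0 := by positivity
  have h4 := pi_ne_zero
  field_simp at h2
  exact_mod_cast h2

theorem eval_neg_tan_sq_eq_zero {M k : ℕ} (hk : k ∈ Finset.Icc 1 M) {A B : Polynomial ℝ}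
    (h : ∀ z : ℂ, (z + 1) ^ (2 * M + 1) =
      Polynomial.aeval (z ^ 2) A + z * Polynomial.aeval (z ^ 2) B) :
    B.eval (-Real.tan ((k : ℝ) * π / (2 * (M : ℝ) + 1)) ^ 2) = 0 := by
  have hθ := angle_pos_and_lt_pi_div_two hk
  have hN : ((2 * M + 1 : ℕ) : ℝ) * ((k : ℝ) * π / (2 * (M : ℝ) + 1)) = k * π := by
    push_cast
    field_simp
  set θ := (k : ℝ) * π / (2 * (M : ℝ) + 1)
  have hc : 0 < Real.cos θ := cos_pos_of_mem_Ioo ⟨by linarith [pi_pos], hθ.2⟩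
  have ht : 0 < Real.tan θ := tan_pos_of_pos_of_lt_pi_div_two hθ.1 hθ.2
  have hz := h (Real.tan θ * Complex.I)
  have hsq : ((Real.tan θ : ℂ) * Complex.I) ^ 2 = algebraMap ℝ ℂ (-Real.tan θ ^ 2) := by
    simp [mul_pow]
  rw [hsq, Polynomial.aeval_algebraMap_apply, Polynomial.aeval_algebraMap_apply] at hz
  have hp : ((Real.cos θ : ℂ)) ^ (2 * M + 1) * (Real.tan θ * Complex.I + 1) ^ (2 * M + 1) =
      Real.cos (k * π) + Real.sin (k * π) * Complex.I := by
    rw [← mul_pow, ← hN]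
    have : (Real.cos θ : ℂ) * (Real.tan θ * Complex.I + 1) =
        Complex.cos θ + Complex.sin θ * Complex.I := by
      have := Real.tan_mul_cos hc.ne'
      rw [← Complex.ofReal_cos, ← Complex.ofReal_sin, ← this]
      push_cast
      ring
    rw [this, Complex.cos_add_sin_mul_I_pow]
    push_cast
    rfl
  rw [hz, sin_nat_mul_pi] at hp
  have him := congrArg Complex.im hp
  have hre : ∀ x y u v : ℝ, ((x : ℂ) * (y + u * Complex.I * v)).im = x * (u * v) :=
      fun x y u v ↦ by
    simp
  simp only [Complex.coe_algebraMap, Polynomial.coe_aeval_eq_eval] at him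
  rw [← Complex.ofReal_pow, hre] at him
  simpa only [Complex.ofReal_zero, zero_mul, add_zero, Complex.ofReal_im, mul_eq_zero,
    pow_eq_zero_iff (Nat.succ_ne_zero _), hc.ne', ht.ne', false_or] using him

theorem odd_part_eq_prod (M : ℕ) : ∃ B : Polynomial ℝ,
    (∀ a : ℝ, (a + 1) ^ (2 * M + 1) + (a - 1) ^ (2 * M + 1) = 2 * a * B.eval (a ^ 2)) ∧
    B = ∏ k ∈ Finset.Icc 1 M, (Polynomial.X +
      Polynomial.C (Real.tan ((k : ℝ) * π / (2 * (M : ℝ) + 1)) ^ 2)) ∧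
    (Polynomial.X * B).coeff M = (M : ℝ) * (2 * M + 1) := by
  obtain ⟨A, B, h, -, -, hB, hB', hB''⟩ := exists_even_odd_parts M
  refine ⟨B, fun a ↦ ?_, ?_, hB''⟩
  · have h1 := h a
    have h2 := h (-a : ℝ)
    have e : (-a + 1) ^ (2 * M + 1) = -(a - 1) ^ (2 * M + 1) := by
      rw [← Odd.neg_pow ⟨M, rfl⟩]; ring
    rw [← Complex.ofReal_pow, ← Complex.coe_algebraMap, Polynomial.aeval_algebraMap_apply,
      Polynomial.aeval_algebraMap_apply] at h1 h2
    simp only [Complex.coe_algebraMap, Polynomial.coe_aeval_eq_eval] at h1 h2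
    norm_cast at h1 h2
    rw [e, neg_sq] at h2
    linarith
  · set P := ∏ k ∈ Finset.Icc 1 M, (Polynomial.X +
      Polynomial.C (Real.tan ((k : ℝ) * π / (2 * (M : ℝ) + 1)) ^ 2)) with hP
    have hPm : P.Monic := Polynomial.monic_prod_of_monic _ _ fun k _ ↦ Polynomial.monic_X_add_C _
    have hPd : P.natDegree = M := by
      rw [hP, Polynomial.natDegree_prod_of_monic _ _ fun k _ ↦ Polynomial.monic_X_add_C _]
      simp only [Polynomial.natDegree_X_add_C]
      simp
    have hlt : (B - P).degree < M := by
      rw [Polynomial.degree_lt_iff_coeff_zero]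
      intro n hn
      rw [Polynomial.coeff_sub]
      rcases hn.eq_or_lt with rfl | hn
      · have := hPm.coeff_natDegree
        rw [hPd] at this
        rw [hB', this, sub_self]
      · rw [Polynomial.coeff_eq_zero_of_natDegree_lt (by omega),
          Polynomial.coeff_eq_zero_of_natDegree_lt (by omega), sub_self]
    refine Polynomial.eq_of_degree_sub_lt_of_eval_index_eq (Finset.Icc 1 M) (tan_sq_injOn M)
      (by simpa using hlt) fun k hk ↦ ?_
    rw [eval_neg_tan_sq_eq_zero hk h, hP, Polynomial.eval_prod, eq_comm]
    exact Finset.prod_eq_zero hk (by simp)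

theorem sum_tan_sq (M : ℕ) :
    ∑ k ∈ Finset.Icc 1 M, Real.tan ((k : ℝ) * π / (2 * (M : ℝ) + 1)) ^ 2 = M * (2 * M + 1) := by
  obtain ⟨B, -, hB, hc⟩ := odd_part_eq_prod M
  have hn : B.nextCoeff =
      ∑ k ∈ Finset.Icc 1 M, Real.tan ((k : ℝ) * π / (2 * (M : ℝ) + 1)) ^ 2 := by
    rw [hB, Polynomial.Monic.nextCoeff_prod _ _ fun k _ ↦ Polynomial.monic_X_add_C _]
    simp only [Polynomial.nextCoeff_X_add_C]
  have hd : B.natDegree = M := by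
    rw [hB, Polynomial.natDegree_prod_of_monic _ _ fun k _ ↦ Polynomial.monic_X_add_C _]
    simp only [Polynomial.natDegree_X_add_C]
    simp
  rw [← hn, ← hc]
  rcases M with _ | M
  · simp [Polynomial.nextCoeff, hd]
  · rw [Polynomial.nextCoeff_of_natDegree_pos (by omega), hd, Polynomial.coeff_X_mul,
      Nat.add_sub_cancel]

theorem add_one_pow_add_sub_one_pow (M : ℕ) (a : ℝ) :
    (a + 1) ^ (2 * M + 1) + (a - 1) ^ (2 * M + 1) = 2 * a *
      ∏ k ∈ Finset.Icc 1 M, (a ^ 2 + Real.tan ((k : ℝ) * π / (2 * (M : ℝ) + 1)) ^ 2) := by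
  obtain ⟨B, h, hB, -⟩ := odd_part_eq_prod M
  rw [h, hB, Polynomial.eval_prod]
  simp

theorem logDeriv_add_one_pow_add_sub_one_pow (M : ℕ) {a : ℝ} (ha : 0 < a) :
    (2 * (M : ℝ) + 1) * ((a + 1) ^ (2 * M) + (a - 1) ^ (2 * M)) /
      ((a + 1) ^ (2 * M + 1) + (a - 1) ^ (2 * M + 1)) = 1 / a +
      ∑ k ∈ Finset.Icc 1 M,
        2 * a / (a ^ 2 + Real.tan ((k : ℝ) * π / (2 * (M : ℝ) + 1)) ^ 2) := by
  have hf : (fun x : ℝ ↦ (x + 1) ^ (2 * M + 1) + (x - 1) ^ (2 * M + 1)) = fun x ↦ (2 * x) *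
      ∏ k ∈ Finset.Icc 1 M, (x ^ 2 + Real.tan ((k : ℝ) * π / (2 * (M : ℝ) + 1)) ^ 2) :=
    funext (add_one_pow_add_sub_one_pow M)
  have h1 : HasDerivAt (fun x : ℝ ↦ (x + 1) ^ (2 * M + 1) + (x - 1) ^ (2 * M + 1))
      ((2 * (M : ℝ) + 1) * ((a + 1) ^ (2 * M) + (a - 1) ^ (2 * M))) a := by
    have h := (((hasDerivAt_id' a).add_const 1).fun_pow (2 * M + 1)).add
      (((hasDerivAt_id' a).sub_const 1).fun_pow (2 * M + 1))
    refine h.congr_deriv ?_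
    push_cast
    ring
  have h2 := congrArg (fun f ↦ logDeriv f a) hf
  have hne : ∀ k ∈ Finset.Icc 1 M,
      a ^ 2 + Real.tan ((k : ℝ) * π / (2 * (M : ℝ) + 1)) ^ 2 ≠ 0 := fun k _ ↦ by positivity
  beta_reduce at h2
  rw [logDeriv_apply, h1.deriv, logDeriv_mul (f := fun x ↦ 2 * x) a (by positivity)
      (Finset.prod_ne_zero_iff.mpr hne)
    (by fun_prop) (by fun_prop),
    logDeriv_prod (f := fun (k : ℕ) (x : ℝ) ↦
      x ^ 2 + Real.tan ((k : ℝ) * π / (2 * (M : ℝ) + 1)) ^ 2) hne fun k _ ↦ by fun_prop] at h2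
  rw [h2]
  congr 1
  · rw [logDeriv_const_mul _ _ two_ne_zero, logDeriv_id']
  · refine Finset.sum_congr rfl fun k _ ↦ ?_
    simp [logDeriv_apply]

/-- Closed-form identity for the diagonal Padé approximant of the square root. -/
theorem pade_sqrt_closed_form (M : ℕ) (a : ℝ) (ha : 0 < a) :
    (2 * (M:ℝ) + 1) -
      ∑ k ∈ Finset.Icc 1 M,
        (2 * Real.tan ((k:ℝ) * π / (2 * (M:ℝ) + 1)) ^ 2 *
            (1 + Real.tan ((k:ℝ) * π / (2 * (M:ℝ) + 1)) ^ 2) / (2 * (M:ℝ) + 1)) /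
          (a ^ 2 + Real.tan ((k:ℝ) * π / (2 * (M:ℝ) + 1)) ^ 2)
    = a * ((a + 1) ^ (2 * M + 1) - (a - 1) ^ (2 * M + 1)) /
        ((a + 1) ^ (2 * M + 1) + (a - 1) ^ (2 * M + 1)) := by
  have hN : (2 * (M : ℝ) + 1) ≠ 0 := by positivity
  have hD : (a + 1) ^ (2 * M + 1) + (a - 1) ^ (2 * M + 1) ≠ 0 := by
    rw [add_one_pow_add_sub_one_pow]
    have := Finset.prod_pos (s := Finset.Icc 1 M)
      (f := fun k : ℕ ↦ a ^ 2 + Real.tan ((k : ℝ) * π / (2 * (M : ℝ) + 1)) ^ 2)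
      fun k _ ↦ by positivity
    positivity
  have hlog := logDeriv_add_one_pow_add_sub_one_pow M ha
  have hsum : ∑ k ∈ Finset.Icc 1 M,
        (2 * Real.tan ((k:ℝ) * π / (2 * (M:ℝ) + 1)) ^ 2 *
            (1 + Real.tan ((k:ℝ) * π / (2 * (M:ℝ) + 1)) ^ 2) / (2 * (M:ℝ) + 1)) /
          (a ^ 2 + Real.tan ((k:ℝ) * π / (2 * (M:ℝ) + 1)) ^ 2) =
      2 / (2 * (M : ℝ) + 1) * (M * (1 - a ^ 2) + M * (2 * M + 1)) -
        (1 - a ^ 2) * a / (2 * (M : ℝ) + 1) * ∑ k ∈ Finset.Icc 1 M,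
          2 * a / (a ^ 2 + Real.tan ((k : ℝ) * π / (2 * (M : ℝ) + 1)) ^ 2) := by
    have hconst : (M : ℝ) * (1 - a ^ 2) = ∑ k ∈ Finset.Icc 1 M, (1 - a ^ 2) := by
      rw [Finset.sum_const, Nat.card_Icc, Nat.add_sub_cancel, nsmul_eq_mul]
    rw [← sum_tan_sq, hconst, ← Finset.sum_add_distrib, Finset.mul_sum, Finset.mul_sum,
      ← Finset.sum_sub_distrib]
    refine Finset.sum_congr rfl fun k _ ↦ ?_
    generalize Real.tan ((k : ℝ) * π / (2 * (M : ℝ) + 1)) = t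
    have : a ^ 2 + t ^ 2 ≠ 0 := by positivity
    field_simp
    ring
  have hquot : a * ((a + 1) ^ (2 * M + 1) - (a - 1) ^ (2 * M + 1)) /
        ((a + 1) ^ (2 * M + 1) + (a - 1) ^ (2 * M + 1)) = a ^ 2 +
      (1 - a ^ 2) * a / (2 * (M : ℝ) + 1) *
        ((2 * (M : ℝ) + 1) * ((a + 1) ^ (2 * M) + (a - 1) ^ (2 * M)) /
      ((a + 1) ^ (2 * M + 1) + (a - 1) ^ (2 * M + 1))) := by
    field_simp
    ring
  rw [hquot, hlog, hsum]
  generalize ∑ k ∈ Finset.Icc 1 M,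
    2 * a / (a ^ 2 + Real.tan ((k : ℝ) * π / (2 * (M : ℝ) + 1)) ^ 2) = S
  field_simp
  ring
end

section
/- Let M ∈ ℕ and set θ_k = kπ/(2M+1), η_k = tan θ_k for k = 1,…,M, b₀ = 2M+1, and b_k = 2η_k²(1+η_k²)/(2M+1). Then for every real a > 0 the approximation error of R_M(z) = b₀ − Σ_{k=1}^{M} b_k/(z + η_k²) to the square root satisfies the exact formula R_M(a²) − a = −2a (a−1)^{2M+1} / ((a+1)^{2M+1} + (a−1)^{2M+1}); in particular R_M(a²) − a vanishes to order 2M+1 at a = 1. -/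
open Real Finset

theorem sum_pow_eq_ite_of_pow_eq_one {K : Type*} [Field K] [DecidableEq K] {w : K} {n : ℕ}
    (hw : w ^ n = 1) :
    ∑ k ∈ range n, w ^ k = if w = 1 then (n : K) else 0 := by
  split_ifs with h
  · simp [h]
  · rw [geom_sum_eq h, hw, sub_self, zero_div]

theorem sum_inv_add_mul_pow {K : Type*} [Field K] {ζ p q : K} {n : ℕ}
    (hζ : IsPrimitiveRoot ζ n) (hn : Odd n) (h : p ^ n + q ^ n ≠ 0) :
    ∑ k ∈ range n, (p + q * ζ ^ k)⁻¹ = n * p ^ (n - 1) / (p ^ n + q ^ n) := by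
  classical
  have hpos : 0 < n := hn.pos
  have key (k : ℕ) : (p + q * ζ ^ k)⁻¹ =
      (∑ i ∈ range n, (-q) ^ i * p ^ (n - 1 - i) * (ζ ^ i) ^ k) / (p ^ n + q ^ n) := by
    have e := (Commute.all (-(q * ζ ^ k)) p).geom_sum₂_mul n
    have e1 : (-(q * ζ ^ k)) ^ n = -q ^ n := by
      rw [hn.neg_pow, mul_pow, ← pow_mul, mul_comm k, pow_mul, hζ.pow_eq_one, one_pow, mul_one]
    have e2 : ∑ i ∈ range n, (-(q * ζ ^ k)) ^ i * p ^ (n - 1 - i) =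
        ∑ i ∈ range n, (-q) ^ i * p ^ (n - 1 - i) * (ζ ^ i) ^ k := by
      refine sum_congr rfl fun i _ => ?_
      rw [← neg_mul, mul_pow, ← pow_mul, ← pow_mul, mul_comm k]
      ring
    rw [e1, e2] at e
    have hne : p + q * ζ ^ k ≠ 0 := by
      intro h0
      apply h
      linear_combination e + (∑ i ∈ range n, (-q) ^ i * p ^ (n - 1 - i) * (ζ ^ i) ^ k) * h0
    rw [inv_eq_iff_eq_inv, inv_div, eq_div_iff]
    · linear_combination -e
    · intro h0
      rw [h0] at e
      apply h
      linear_combination e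
  simp_rw [key]
  rw [← sum_div, sum_comm]
  congr 1
  rw [sum_eq_single_of_mem 0 (mem_range.2 hpos)]
  · simp [mul_comm]
  · intro i hi hi0
    have h1 : (ζ ^ i) ^ n = 1 := by rw [← pow_mul, mul_comm, pow_mul, hζ.pow_eq_one, one_pow]
    rw [← mul_sum, sum_pow_eq_ite_of_pow_eq_one h1,
      if_neg (hζ.pow_ne_one_of_pos_of_lt hi0 (mem_range.1 hi)), mul_zero]

theorem sum_four_div_one_add_pow_mul {K : Type*} [Field K] [NeZero (2 : K)] {ζ : K} {n : ℕ}
    (hζ : IsPrimitiveRoot ζ n) (hn : Odd n) :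
    ∑ k ∈ range n, 4 / ((1 + ζ ^ k) * (1 + ζ⁻¹ ^ k)) = (n : K) ^ 2 := by
  classical
  have h2 : (2 : K) ≠ 0 := NeZero.ne 2
  have hζ0 : ζ ≠ 0 := hζ.ne_zero hn.pos.ne'
  have key {ξ : K} (hξ : ξ ^ n = 1) (k : ℕ) :
      2 / (1 + ξ ^ k) = ∑ i ∈ range n, (-(ξ ^ k)) ^ i := by
    have e := geom_sum_mul (-(ξ ^ k)) n
    rw [hn.neg_pow, ← pow_mul, mul_comm k, pow_mul, hξ, one_pow] at e
    rw [div_eq_iff]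
    · linear_combination e
    · intro h0
      apply h2
      linear_combination e + (∑ i ∈ range n, (-(ξ ^ k)) ^ i) * h0
  have hinv : ζ⁻¹ ^ n = 1 := by rw [inv_pow, hζ.pow_eq_one, inv_one]
  have expand (k : ℕ) : 4 / ((1 + ζ ^ k) * (1 + ζ⁻¹ ^ k)) =
      ∑ i ∈ range n, ∑ j ∈ range n, (-1) ^ (i + j) * (ζ ^ i * ζ⁻¹ ^ j) ^ k := by
    rw [show (4 : K) = 2 * 2 by norm_num, mul_div_mul_comm, key hζ.pow_eq_one, key hinv,
      sum_mul_sum]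
    refine sum_congr rfl fun i _ => sum_congr rfl fun j _ => ?_
    rw [neg_pow, neg_pow (ζ⁻¹ ^ k), mul_pow, pow_right_comm ζ, pow_right_comm ζ⁻¹]
    ring
  simp_rw [expand]
  rw [sum_comm]
  have inner (i : ℕ) (hi : i ∈ range n) : ∑ k ∈ range n, ∑ j ∈ range n,
      (-1) ^ (i + j) * (ζ ^ i * ζ⁻¹ ^ j) ^ k = (n : K) := by
    rw [sum_comm, sum_eq_single_of_mem i hi]
    · simp [mul_inv_cancel₀ (pow_ne_zero i hζ0), ← two_mul]
    · intro j hj hji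
      have h1 : (ζ ^ i * ζ⁻¹ ^ j) ^ n = 1 := by
        rw [mul_pow, pow_right_comm ζ, pow_right_comm ζ⁻¹, hζ.pow_eq_one, hinv]
        simp
      rw [← mul_sum, sum_pow_eq_ite_of_pow_eq_one h1, if_neg, mul_zero]
      intro h
      rw [inv_pow, mul_inv_eq_one₀ (pow_ne_zero _ hζ0)] at h
      exact hji (hζ.pow_inj (mem_range.1 hi) (mem_range.1 hj) h).symm
  rw [sum_congr rfl inner]
  simp [sq]

theorem sum_range_two_mul_add_one_of_symm {A : Type*} [Semiring A] (M : ℕ) (f : ℕ → A)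
    (hf : ∀ k ∈ Icc 1 M, f (2 * M + 1 - k) = f k) :
    ∑ k ∈ range (2 * M + 1), f k = f 0 + 2 * ∑ k ∈ Icc 1 M, f k := by
  rw [sum_range_succ', add_comm, two_mul M, sum_range_add, two_mul]
  have h1 : ∑ k ∈ Icc 1 M, f k = ∑ k ∈ range M, f (k + 1) := by
    rw [range_eq_Ico, sum_Ico_add' f 0 M 1]
    rfl
  congr 2
  · exact h1.symm
  · rw [h1, ← sum_range_reflect]
    refine sum_congr rfl fun k hk => ?_
    have hk := mem_range.1 hk
    rw [← hf (k + 1) (by simp; omega)]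
    congr 1
    omega

theorem add_mul_exp_mul_add_mul_exp_inv (p q θ : ℝ) :
    ((p : ℂ) + q * Complex.exp (2 * θ * Complex.I)) *
        (p + q * (Complex.exp (2 * θ * Complex.I))⁻¹) =
      (((p + q) ^ 2 * cos θ ^ 2 + (p - q) ^ 2 * sin θ ^ 2 : ℝ) : ℂ) := by
  have hne := Complex.exp_ne_zero (2 * θ * Complex.I)
  have h : Complex.exp (2 * θ * Complex.I) + (Complex.exp (2 * θ * Complex.I))⁻¹ =
      2 * (2 * Complex.cos θ ^ 2 - 1) := by
    rw [← Complex.cos_two_mul, ← Complex.exp_neg, Complex.cos]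
    ring_nf
  have hs := Complex.sin_sq_add_cos_sq θ
  push_cast
  linear_combination (p * q : ℂ) * h + (q : ℂ) ^ 2 * mul_inv_cancel₀ hne
    - ((p : ℂ) - q) ^ 2 * hs

theorem exp_two_mul_mul_div (n k : ℕ) :
    Complex.exp (2 * π * Complex.I / n) ^ k =
      Complex.exp (2 * ((k * π / n : ℝ) : ℂ) * Complex.I) := by
  rw [← Complex.exp_nat_mul]
  push_cast
  ring_nf

theorem sum_inv_cos_sq {n : ℕ} (hn : Odd n) :
    ∑ k ∈ range n, (cos (k * π / n) ^ 2)⁻¹ = (n : ℝ) ^ 2 := by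
  have hζ := Complex.isPrimitiveRoot_exp n hn.pos.ne'
  have h := sum_four_div_one_add_pow_mul hζ hn
  apply Complex.ofReal_injective
  push_cast
  rw [← h]
  refine sum_congr rfl fun k _ => ?_
  have e := add_mul_exp_mul_add_mul_exp_inv 1 1 (k * π / n)
  rw [← exp_two_mul_mul_div] at e
  rw [inv_pow]
  push_cast at e
  simp only [one_mul] at e
  rw [e]
  norm_num
  ring

theorem sum_inv_sq_mul_cos_sq_add_sin_sq {n : ℕ} (hn : Odd n) {a : ℝ} (ha : 0 < a) :
    ∑ k ∈ range n, (a ^ 2 * cos (k * π / n) ^ 2 + sin (k * π / n) ^ 2)⁻¹ =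
      n / a * (((a + 1) ^ n - (a - 1) ^ n) / ((a + 1) ^ n + (a - 1) ^ n)) := by
  have hD : (a + 1) ^ n + (a - 1) ^ n ≠ 0 := by
    have h : (1 - a) ^ n < (a + 1) ^ n := hn.strictMono_pow (by linarith)
    rw [← neg_sub, hn.neg_pow] at h
    linarith
  have hDc : ((a : ℂ) + 1) ^ n + ((a : ℂ) - 1) ^ n ≠ 0 := by exact_mod_cast hD
  have ha' : (a : ℂ) ≠ 0 := by exact_mod_cast ha.ne'
  have hζ := Complex.isPrimitiveRoot_exp n hn.pos.ne'
  have h1 := sum_inv_add_mul_pow hζ hn hDc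
  have h2 := sum_inv_add_mul_pow hζ.inv hn hDc
  have term (k : ℕ) :
      (((a ^ 2 * cos (k * π / n) ^ 2 + sin (k * π / n) ^ 2)⁻¹ : ℝ) : ℂ) =
      (a : ℂ)⁻¹ * ((a + 1) * (((a + 1 : ℂ) + (a - 1) * Complex.exp (2 * π * Complex.I / n) ^ k)⁻¹ +
        ((a + 1 : ℂ) + (a - 1) * (Complex.exp (2 * π * Complex.I / n))⁻¹ ^ k)⁻¹) - 1) := by
    have e := add_mul_exp_mul_add_mul_exp_inv (a + 1) (a - 1) (k * π / n)
    have hne : a ^ 2 * cos (k * π / n) ^ 2 + sin (k * π / n) ^ 2 ≠ 0 := by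
      have hs := sin_sq_add_cos_sq (k * π / n)
      rcases eq_or_ne (sin (k * π / n)) 0 with h | h
      · have : cos (k * π / n) ^ 2 = 1 := by rw [h] at hs; linarith
        rw [h, this]
        positivity
      · positivity
    rw [show ((a + 1 + (a - 1)) ^ 2 * cos (k * π / n) ^ 2 +
        (a + 1 - (a - 1)) ^ 2 * sin (k * π / n) ^ 2) =
        4 * (a ^ 2 * cos (k * π / n) ^ 2 + sin (k * π / n) ^ 2) by ring,
      ← exp_two_mul_mul_div] at e
    rw [inv_pow]
    have hz := mul_inv_cancel₀ (pow_ne_zero k (hζ.ne_zero hn.pos.ne'))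
    generalize a ^ 2 * cos (k * π / n) ^ 2 + sin (k * π / n) ^ 2 = c at *
    generalize Complex.exp (2 * π * Complex.I / n) ^ k = z at *
    generalize z⁻¹ = w at *
    have hc : (c : ℂ) ≠ 0 := by exact_mod_cast hne
    push_cast at e ⊢
    have hx : ((a : ℂ) + 1 + (a - 1) * z) ≠ 0 := by
      intro h; rw [h, zero_mul] at e; exact hc (by linear_combination -e / 4)
    have hy : ((a : ℂ) + 1 + (a - 1) * w) ≠ 0 := by
      intro h; rw [h, mul_zero] at e; exact hc (by linear_combination -e / 4)
    have hc' : (c : ℂ) = ((a : ℂ) + 1 + (a - 1) * z) * (a + 1 + (a - 1) * w) / 4 := by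
      linear_combination -e / 4
    rw [hc']
    field_simp
    linear_combination ((a : ℂ) - 1) ^ 2 * hz
  apply Complex.ofReal_injective
  rw [Complex.ofReal_sum, sum_congr rfl fun k _ => term k, ← mul_sum, sum_sub_distrib, ← mul_sum,
    sum_add_distrib, h1, h2]
  obtain ⟨m, rfl⟩ := hn
  push_cast
  simp only [sum_const, card_range, nsmul_eq_mul]
  push_cast
  field_simp
  ring

theorem cos_mul_pi_div_two_mul_add_one_ne_zero {M k : ℕ} (hk : k ≤ M) :
    cos (k * π / (2 * M + 1)) ≠ 0 := by
  have hk' : (k : ℝ) ≤ M := by exact_mod_cast hk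
  have hM : (0 : ℝ) < 2 * M + 1 := by positivity
  refine (cos_pos_of_mem_Ioo ⟨?_, ?_⟩).ne'
  · have : 0 ≤ k * π / (2 * M + 1) := by positivity
    linarith [pi_pos]
  · rw [div_lt_iff₀ hM]
    nlinarith [pi_pos]

/-- Exact error formula for the diagonal Padé approximant of the square root. -/
theorem pade_sqrt_error_formula (M : ℕ) (a : ℝ) (ha : 0 < a) :
    ((2 * (M:ℝ) + 1) -
      ∑ k ∈ Finset.Icc 1 M,
        (2 * Real.tan ((k:ℝ) * π / (2 * (M:ℝ) + 1)) ^ 2 *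
            (1 + Real.tan ((k:ℝ) * π / (2 * (M:ℝ) + 1)) ^ 2) / (2 * (M:ℝ) + 1)) /
          (a ^ 2 + Real.tan ((k:ℝ) * π / (2 * (M:ℝ) + 1)) ^ 2)) - a
    = -2 * a * (a - 1) ^ (2 * M + 1) /
        ((a + 1) ^ (2 * M + 1) + (a - 1) ^ (2 * M + 1)) := by
  have hodd : Odd (2 * M + 1) := odd_two_mul_add_one M
  have hM : (2 * (M : ℝ) + 1) ≠ 0 := by positivity
  have hD : (a + 1) ^ (2 * M + 1) + (a - 1) ^ (2 * M + 1) ≠ 0 := by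
    have h : (1 - a) ^ (2 * M + 1) < (a + 1) ^ (2 * M + 1) := hodd.strictMono_pow (by linarith)
    rw [← neg_sub, hodd.neg_pow] at h
    linarith
  have hrefl (k : ℕ) (hk : k ∈ Icc 1 M) :
      ((2 * M + 1 - k : ℕ) : ℝ) * π / (2 * M + 1) = π - k * π / (2 * M + 1) := by
    have := mem_Icc.1 hk
    rw [Nat.cast_sub (by omega)]
    push_cast
    field_simp
  have h1 := sum_inv_cos_sq hodd
  have h2 := sum_inv_sq_mul_cos_sq_add_sin_sq hodd ha
  push_cast at h1 h2
  rw [sum_range_two_mul_add_one_of_symm M _ fun k hk => by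
    rw [hrefl k hk, cos_pi_sub, neg_sq]] at h1
  rw [sum_range_two_mul_add_one_of_symm M _ fun k hk => by
    rw [hrefl k hk, cos_pi_sub, sin_pi_sub, neg_sq]] at h2
  have hterm : ∀ k ∈ Icc 1 M,
      (2 * tan (k * π / (2 * M + 1)) ^ 2 * (1 + tan (k * π / (2 * M + 1)) ^ 2) / (2 * M + 1)) /
        (a ^ 2 + tan (k * π / (2 * M + 1)) ^ 2) =
      2 / (2 * M + 1) * ((cos (k * π / (2 * M + 1)) ^ 2)⁻¹ -
        a ^ 2 * (a ^ 2 * cos (k * π / (2 * M + 1)) ^ 2 + sin (k * π / (2 * M + 1)) ^ 2)⁻¹) := by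
    intro k hk
    have hc := cos_mul_pi_div_two_mul_add_one_ne_zero (mem_Icc.1 hk).2
    have hs := sin_sq_add_cos_sq (k * π / (2 * M + 1))
    rw [tan_eq_sin_div_cos]
    generalize cos (k * π / (2 * M + 1)) = c at *
    generalize sin (k * π / (2 * M + 1)) = s at *
    have hne : a ^ 2 * c ^ 2 + s ^ 2 ≠ 0 := by positivity
    have e1 : 1 + (s / c) ^ 2 = (c ^ 2)⁻¹ := by
      field_simp
      linarith
    have e2 : a ^ 2 + (s / c) ^ 2 = (a ^ 2 * c ^ 2 + s ^ 2) / c ^ 2 := by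
      field_simp
    rw [e1, e2]
    field_simp
    ring
  rw [sum_congr rfl hterm, ← mul_sum, sum_sub_distrib, ← mul_sum]
  simp only [Nat.cast_zero, zero_mul, zero_div, cos_zero, sin_zero] at h1 h2
  generalize ∑ k ∈ Icc 1 M, (cos (k * π / (2 * M + 1)) ^ 2)⁻¹ = C at *
  generalize ∑ k ∈ Icc 1 M,
    (a ^ 2 * cos (k * π / (2 * M + 1)) ^ 2 + sin (k * π / (2 * M + 1)) ^ 2)⁻¹ = S at *
  have hC : C = ((2 * M + 1) ^ 2 - 1) / 2 := by
    norm_num at h1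
    linarith
  have hS : S = ((2 * M + 1) / a * (((a + 1) ^ (2 * M + 1) - (a - 1) ^ (2 * M + 1)) /
      ((a + 1) ^ (2 * M + 1) + (a - 1) ^ (2 * M + 1))) - (a ^ 2)⁻¹) / 2 := by
    norm_num at h2
    linarith
  rw [hC, hS]
  generalize (a + 1) ^ (2 * M + 1) = P at *
  generalize (a - 1) ^ (2 * M + 1) = Q at *
  field_simp
  ring
end

section
/- Let φ : ℝ × ℝ → ℂ be continuous and let η, η′ ∈ ℝ. Define φ_k(τ₁,τ₂) = ∫₀^{τ₁} e^{−η²(τ₁−s)} φ(s,τ₂) ds, ψ(τ₁,τ₂) = ∫₀^{τ₂} e^{−η′²(τ₂−s)} φ_k(τ₁,s) ds, and φ_{k′}(τ₁,τ₂) = ∫₀^{τ₂} e^{−η′²(τ₂−s)} φ(τ₁,s) ds. Then for every τ₂ ≥ 0 and τ₁ ≥ 0, the map τ₁ ↦ ψ(τ₁,τ₂) is differentiable and satisfies the ordinary differential equation ∂_{τ₁} ψ(τ₁,τ₂) + η² ψ(τ₁,τ₂) = φ_{k′}(τ₁,τ₂). -/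
open MeasureTheory Real

/-- The exponential smoothing `t ↦ ∫₀ᵗ e^{-a(t-s)} g(s) ds` of a continuous function solves the
relaxation equation `y' = g - a y`. -/
theorem hasDerivAt_integral_exp_smoothing {g : ℝ → ℂ} (hg : Continuous g) (a t : ℝ) :
    HasDerivAt (fun τ : ℝ => ∫ s in (0:ℝ)..τ, (Real.exp (-a * (τ - s)) : ℂ) * g s)
      (g t - (a : ℂ) * ∫ s in (0:ℝ)..t, (Real.exp (-a * (t - s)) : ℂ) * g s) t := by
  have hfactor : ∀ τ : ℝ, (∫ s in (0:ℝ)..τ, (Real.exp (-a * (τ - s)) : ℂ) * g s) =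
      (Real.exp (-a * τ) : ℂ) * ∫ s in (0:ℝ)..τ, (Real.exp (a * s) : ℂ) * g s := by
    intro τ
    rw [← intervalIntegral.integral_const_mul]
    refine intervalIntegral.integral_congr fun s _ => ?_
    rw [← mul_assoc, ← Complex.ofReal_mul, ← Real.exp_add]
    ring_nf
  have hexp : HasDerivAt (fun τ : ℝ => (Real.exp (-a * τ) : ℂ))
      ((Real.exp (-a * t) * (-a) : ℝ) : ℂ) t := by
    simpa using (((hasDerivAt_id t).const_mul (-a)).exp).ofReal_comp
  have hint : HasDerivAt (fun τ : ℝ => ∫ s in (0:ℝ)..τ, (Real.exp (a * s) : ℂ) * g s)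
      ((Real.exp (a * t) : ℂ) * g t) t :=
    (Continuous.integral_hasStrictDerivAt (f := fun s : ℝ => (Real.exp (a * s) : ℂ) * g s)
      (by fun_prop) 0 t).hasDerivAt
  have hcancel : (Real.exp (-a * t) : ℂ) * (Real.exp (a * t) : ℂ) = 1 := by
    rw [← Complex.ofReal_mul, ← Real.exp_add]
    simp
  simp only [hfactor]
  refine (hexp.mul hint).congr_deriv ?_
  rw [Complex.ofReal_mul, Complex.ofReal_neg]
  linear_combination g t * hcancel

/-- Smoothings in two different variables commute. -/
theorem integral_smoothing_comm {φ : ℝ × ℝ → ℂ} (hφ : Continuous φ) {K L : ℝ → ℂ}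
    (hK : Continuous K) (hL : Continuous L) (a b c d : ℝ) :
    (∫ y in c..d, L y * ∫ x in a..b, K x * φ (x, y)) =
      ∫ x in a..b, K x * ∫ y in c..d, L y * φ (x, y) := by
  simp only [← intervalIntegral.integral_const_mul]
  rw [intervalIntegral_intervalIntegral_swap]
  · simp only [mul_left_comm]
  · refine IntegrableOn.mono_set ?_
      (Set.prod_mono Set.uIoc_subset_uIcc Set.uIoc_subset_uIcc)
    refine ContinuousOn.integrableOn_compact (isCompact_uIcc.prod isCompact_uIcc)
      (Continuous.continuousOn ?_)
    unfold Function.uncurry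
    fun_prop

/-- The corner auxiliary field `ψ` satisfies the ODE
`∂_{τ₁} ψ + η² ψ = φ_{k'}` in its first temporal variable. -/
theorem corner_auxiliary_field_ode
    (φ : ℝ × ℝ → ℂ) (hφ : Continuous φ) (η η' : ℝ)
    (φk : ℝ → ℝ → ℂ)
    (hφk : ∀ τ₁ τ₂ : ℝ, φk τ₁ τ₂ =
      ∫ s in (0:ℝ)..τ₁, (Real.exp (-η^2 * (τ₁ - s)) : ℂ) * φ (s, τ₂))
    (ψ : ℝ → ℝ → ℂ)
    (hψ : ∀ τ₁ τ₂ : ℝ, ψ τ₁ τ₂ =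
      ∫ s in (0:ℝ)..τ₂, (Real.exp (-η'^2 * (τ₂ - s)) : ℂ) * φk τ₁ s)
    (φk' : ℝ → ℝ → ℂ)
    (hφk' : ∀ τ₁ τ₂ : ℝ, φk' τ₁ τ₂ =
      ∫ s in (0:ℝ)..τ₂, (Real.exp (-η'^2 * (τ₂ - s)) : ℂ) * φ (τ₁, s)) :
    ∀ τ₂ : ℝ, 0 ≤ τ₂ → ∀ τ₁ : ℝ, 0 ≤ τ₁ →
      HasDerivAt (fun τ => ψ τ τ₂) (φk' τ₁ τ₂ - (η^2 : ℂ) * ψ τ₁ τ₂) τ₁ := by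
  intro τ₂ _ τ₁ _
  have hcont : Continuous fun s => φk' s τ₂ := by
    simp only [hφk']
    apply intervalIntegral.continuous_parametric_intervalIntegral_of_continuous'
    unfold Function.uncurry
    fun_prop
  have hswap : ∀ τ : ℝ, ψ τ τ₂ =
      ∫ s in (0:ℝ)..τ, (Real.exp (-η^2 * (τ - s)) : ℂ) * φk' s τ₂ := by
    intro τ
    simp only [hψ, hφk, hφk']
    exact integral_smoothing_comm hφ (K := fun s => (Real.exp (-η^2 * (τ - s)) : ℂ))
      (L := fun s => (Real.exp (-η'^2 * (τ₂ - s)) : ℂ)) (by fun_prop) (by fun_prop) _ _ _ _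
  simp only [hswap]
  rw [← Complex.ofReal_pow]
  exact hasDerivAt_integral_exp_smoothing hcont (η^2) τ₁
end

section
/- Let λ ∈ ℝ and let w : ℝ → ℂ be continuously differentiable with w(0) = 0. Then for every t > 0 the function F(t) = e^{−iλt} · (1/√π) ∫₀ᵗ (t−s)^{−1/2} e^{iλs} w(s) ds is differentiable and F′(t) = e^{−iλt} · (1/√π) ∫₀ᵗ (t−s)^{−1/2} e^{iλs} w′(s) ds. That is, the time derivative commutes with the exponentially conjugated half-order Riemann–Liouville integral: ∂_t [ e^{−iλt} ∂_t^{−1/2} ( e^{iλt} w ) ] = e^{−iλt} ∂_t^{−1/2} ( e^{iλt} ∂_t w ). -/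
open MeasureTheory Real

/-- Differentiation of a convolution on `[0, x]` of a locally integrable kernel with a `C¹` function
vanishing at the origin. -/
theorem hasDerivAt_integral_mul_comp_sub {k w : ℝ → ℂ}
    (hk : ∀ a b : ℝ, IntervalIntegrable k volume a b) (hw : ContDiff ℝ 1 w) (hw0 : w 0 = 0)
    {t : ℝ} (ht : 0 < t) :
    HasDerivAt (fun x : ℝ => ∫ u in (0:ℝ)..x, k u * w (x - u))
      (∫ u in (0:ℝ)..t, k u * deriv w (t - u)) t := by
  have hwc : Continuous w := hw.continuous
  have hdc : Continuous (deriv w) := hw.continuous_deriv le_rfl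
  obtain ⟨C, hC⟩ := (isCompact_Icc (a := (0:ℝ)) (b := t + 1)).exists_bound_of_continuousOn
    hdc.continuousOn
  have hC0 : 0 ≤ C := (norm_nonneg _).trans (hC 0 ⟨le_rfl, by linarith⟩)
  have hlip : ∀ x ∈ Set.Icc (0:ℝ) (t + 1), ∀ y ∈ Set.Icc (0:ℝ) (t + 1),
      ‖w x - w y‖ ≤ C * ‖x - y‖ := fun x hx y hy =>
    (convex_Icc (0:ℝ) (t + 1)).norm_image_sub_le_of_norm_deriv_le
      (fun z _ => (hw.differentiable one_ne_zero) z) hC hy hx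
  have hs : Set.Ioo (0:ℝ) (t + 1) ∈ nhds t := Ioo_mem_nhds ht (by linarith)
  have hF (x : ℝ) : IntervalIntegrable (fun u => k u * w (max (x - u) 0)) volume 0 (t + 1) :=
    (hk _ _).mul_continuousOn (by fun_prop)
  have hsplit (f g : ℝ → ℂ) (hg : ∀ a b, IntervalIntegrable g volume a b) {x : ℝ}
      (hx : x ∈ Set.Ioo (0:ℝ) (t + 1)) (h1 : ∀ u < x, g u = f u) (h2 : ∀ u, x < u → g u = 0) :
      ∫ u in (0:ℝ)..(t + 1), g u = ∫ u in (0:ℝ)..x, f u := by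
    rw [← intervalIntegral.integral_add_adjacent_intervals (hg 0 x) (hg x (t + 1))]
    have e2 : ∫ u in x..(t + 1), g u = 0 :=
      intervalIntegral.integral_zero_ae (Filter.Eventually.of_forall fun u hu => by
        rw [Set.uIoc_of_le hx.2.le] at hu
        exact h2 u hu.1)
    rw [e2, add_zero]
    refine intervalIntegral.integral_congr_ae ?_
    filter_upwards [Measure.ae_ne volume x] with u hu hmem
    rw [Set.uIoc_of_le hx.1.le] at hmem
    exact h1 u (lt_of_le_of_ne hmem.2 hu)
  have hkd : ∀ a b, IntervalIntegrable (fun u => k u * deriv w (t - u)) volume a b := fun a b =>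
    (hk a b).mul_continuousOn (by fun_prop)
  have hF' : ∀ a b, IntervalIntegrable
      ((Set.Iio t).indicator fun u => k u * deriv w (t - u)) volume a b := fun a b =>
    ⟨(hkd a b).1.indicator measurableSet_Iio, (hkd a b).2.indicator measurableSet_Iio⟩
  have key := (intervalIntegral.hasDerivAt_integral_of_dominated_loc_of_lip
    (μ := volume) (a := 0) (b := t + 1) (x₀ := t)
    (F := fun x u => k u * w (max (x - u) 0))
    (F' := (Set.Iio t).indicator fun u => k u * deriv w (t - u))
    (bound := fun u => ‖k u‖ * C) hs
    (Filter.Eventually.of_forall fun x => (hF x).def'.aestronglyMeasurable) (hF t)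
    (hF' 0 (t + 1)).def'.aestronglyMeasurable
    (Filter.Eventually.of_forall fun u hu => ?_)
    ((hk 0 (t + 1)).norm.mul_const C) ?_).2
  · rw [hsplit _ _ hF' ⟨ht, by linarith⟩ (fun u hu => Set.indicator_of_mem (Set.mem_Iio.2 hu) _)
      (fun u hu => Set.indicator_of_notMem (Set.notMem_Iio.2 hu.le) _)] at key
    refine key.congr_of_eventuallyEq ?_
    filter_upwards [hs] with x hx
    refine (hsplit _ _ (fun a b => (hk a b).mul_continuousOn (by fun_prop)) hx
      (fun u hu => ?_) fun u hu => ?_).symm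
    · rw [max_eq_left (by linarith)]
    · rw [max_eq_right (by linarith), hw0, mul_zero]
  · rw [Set.uIoc_of_le (by linarith)] at hu
    refine LipschitzOnWith.of_dist_le_mul fun x hx y hy => ?_
    have hmem : ∀ z ∈ Set.Ioo (0:ℝ) (t + 1), max (z - u) 0 ∈ Set.Icc (0:ℝ) (t + 1) := fun z hz =>
      ⟨le_max_right _ _, max_le (by linarith [hz.2, hu.1]) (by linarith)⟩
    rw [dist_eq_norm, dist_eq_norm, ← mul_sub, norm_mul, Real.coe_nnabs,
      abs_of_nonneg (by positivity), mul_assoc]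
    gcongr
    refine (hlip _ (hmem x hx) _ (hmem y hy)).trans ?_
    gcongr
    simpa using abs_max_sub_max_le_abs (x - u) (y - u) 0
  · filter_upwards [Measure.ae_ne volume t] with u hut _
    rcases lt_or_gt_of_ne hut with h | h
    · rw [Set.indicator_of_mem (Set.mem_Iio.2 h)]
      have hd : HasDerivAt (fun x => k u * w (x - u)) (k u * deriv w (t - u)) t :=
        (((hw.differentiable one_ne_zero) (t - u)).hasDerivAt.comp_sub_const t u).const_mul (k u)
      refine hd.congr_of_eventuallyEq ?_
      filter_upwards [lt_mem_nhds h] with x hx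
      rw [max_eq_left (by linarith)]
    · rw [Set.indicator_of_notMem (Set.notMem_Iio.2 h.le)]
      refine (hasDerivAt_const t (0:ℂ)).congr_of_eventuallyEq ?_
      filter_upwards [gt_mem_nhds h] with x hx
      rw [max_eq_right (by linarith), hw0, mul_zero]

/-- The exponentially conjugated half-order integral is the convolution with
`u ↦ u ^ (-1/2) * exp (-I * lam * u)`. -/
theorem exp_mul_half_integral_eq_convolution (lam : ℝ) (f : ℝ → ℂ) (t : ℝ) :
    Complex.exp (-(Complex.I * lam * t)) *
      ((1 / (Real.sqrt π : ℂ)) *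
        ∫ s in (0:ℝ)..t,
          Complex.ofReal ((t - s) ^ (-(1/2) : ℝ)) * Complex.exp (Complex.I * lam * s) * f s) =
    (1 / (Real.sqrt π : ℂ)) *
      ∫ u in (0:ℝ)..t,
        Complex.ofReal (u ^ (-(1/2) : ℝ)) * Complex.exp (-(Complex.I * lam * u)) * f (t - u) := by
  have h := intervalIntegral.integral_comp_sub_left (a := 0) (b := t)
    (fun u : ℝ => Complex.ofReal (u ^ (-(1/2) : ℝ)) * Complex.exp (-(Complex.I * lam * u)) *
      f (t - u)) t
  rw [sub_self, sub_zero] at h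
  rw [← h, mul_left_comm, ← intervalIntegral.integral_const_mul]
  congr 2
  ext s
  have he : Complex.exp (-(Complex.I * lam * (t - s : ℝ))) =
      Complex.exp (-(Complex.I * lam * t)) * Complex.exp (Complex.I * lam * s) := by
    rw [← Complex.exp_add]
    congr 1
    push_cast
    ring
  rw [he, sub_sub_cancel]
  ring

/-- The time derivative commutes with the exponentially conjugated half-order
Riemann–Liouville integral. -/
theorem deriv_comm_conjugated_half_integral
    (lam : ℝ) (w : ℝ → ℂ) (hw : ContDiff ℝ 1 w) (hw0 : w 0 = 0) :
    ∀ t : ℝ, 0 < t →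
      HasDerivAt
        (fun t' : ℝ => Complex.exp (-(Complex.I * lam * t')) *
          ((1 / (Real.sqrt π : ℂ)) *
            ∫ s in (0:ℝ)..t',
              Complex.ofReal ((t' - s) ^ (-(1/2) : ℝ)) * Complex.exp (Complex.I * lam * s) * w s))
        (Complex.exp (-(Complex.I * lam * t)) *
          ((1 / (Real.sqrt π : ℂ)) *
            ∫ s in (0:ℝ)..t,
              Complex.ofReal ((t - s) ^ (-(1/2) : ℝ)) * Complex.exp (Complex.I * lam * s) * deriv w s))
        t := by
  intro t ht
  simp only [exp_mul_half_integral_eq_convolution]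
  refine (hasDerivAt_integral_mul_comp_sub (fun a b => ?_) hw hw0 ht).const_mul _
  have hr : IntervalIntegrable (fun u : ℝ => u ^ (-(1/2) : ℝ)) volume a b :=
    intervalIntegral.intervalIntegrable_rpow' (by norm_num)
  have hc : IntervalIntegrable (fun u : ℝ => Complex.ofReal (u ^ (-(1/2) : ℝ))) volume a b :=
    ⟨hr.1.ofReal, hr.2.ofReal⟩
  exact hc.mul_continuousOn (by fun_prop)
end

section
/- Let α ∈ ℂ with Im α > 0 and let x_r ∈ ℝ. Suppose W : ℝ → ℂ is twice differentiable on (x_r, ∞), satisfies W″(x) + α² W(x) = 0 for all x > x_r, and is bounded on (x_r, ∞). Then W′(x) = iα W(x) for all x > x_r. -/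
theorem exp_neg_mul_mul_eq_of_hasDerivAt_mul {c : ℂ} {a : ℝ} {f : ℝ → ℂ}
    (hf : ∀ x ∈ Set.Ioi a, HasDerivAt f (c * f x) x) {x y : ℝ}
    (hx : x ∈ Set.Ioi a) (hy : y ∈ Set.Ioi a) :
    Complex.exp (-c * x) * f x = Complex.exp (-c * y) * f y := by
  have h : ∀ t ∈ Set.Ioi a, HasDerivAt (fun t : ℝ => Complex.exp (-c * t) * f t) 0 t := by
    intro t ht
    refine ((((Complex.ofRealCLM.hasDerivAt (x := t)).const_mul (-c)).cexp).fun_mul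
      (hf t ht)).congr_deriv ?_
    simp only [Complex.ofRealCLM_apply, Complex.ofReal_one]
    ring
  exact isOpen_Ioi.is_const_of_deriv_eq_zero isPreconnected_Ioi
    (fun t ht => (h t ht).differentiableAt.differentiableWithinAt)
    (fun t ht => (h t ht).deriv) hx hy

theorem tendsto_exp_mul_ofReal_atTop_zero {c : ℂ} (hc : c.re < 0) :
    Filter.Tendsto (fun t : ℝ => Complex.exp (c * t)) Filter.atTop (nhds 0) := by
  rw [Complex.tendsto_exp_nhds_zero_iff]
  simpa using Filter.tendsto_id.const_mul_atTop_of_neg hc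

/-- A bounded solution of `W'' + α² W = 0` on a half-line with `Im α > 0`
satisfies the outgoing-wave relation `W' = iαW`. -/
theorem bounded_helmholtz_halfline_outgoing
    (α : ℂ) (hα : 0 < α.im) (xr : ℝ) (W W' : ℝ → ℂ)
    (hW : ∀ x ∈ Set.Ioi xr, HasDerivAt W (W' x) x)
    (hODE : ∀ x ∈ Set.Ioi xr, HasDerivAt W' (-(α^2) * W x) x)
    (hbdd : ∃ C : ℝ, ∀ x ∈ Set.Ioi xr, ‖W x‖ ≤ C) :
    ∀ x ∈ Set.Ioi xr, W' x = Complex.I * α * W x := by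
  intro x hx
  obtain ⟨C, hC⟩ := hbdd
  obtain ⟨k, hk⟩ : ∃ k, k = Complex.I * α := ⟨_, rfl⟩
  have hk2 : -(α ^ 2) = k ^ 2 := by rw [hk, mul_pow, Complex.I_sq]; ring
  have hkre : k.re < 0 := by simpa [hk] using hα
  rw [← hk]
  simp only [hk2] at hODE
  have hV : ∀ t ∈ Set.Ioi xr,
      HasDerivAt (fun t => W' t - k * W t) (-k * (W' t - k * W t)) t := by
    intro t ht
    refine ((hODE t ht).fun_sub ((hW t ht).const_mul k)).congr_deriv ?_
    ring
  have hU : ∀ t ∈ Set.Ioi xr,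
      HasDerivAt (fun t => W' t + k * W t) (k * (W' t + k * W t)) t := by
    intro t ht
    refine ((hODE t ht).fun_add ((hW t ht).const_mul k)).congr_deriv ?_
    ring
  have hexp := tendsto_exp_mul_ofReal_atTop_zero hkre
  have hWexp : Filter.Tendsto (fun t : ℝ => Complex.exp (k * t) * W t) Filter.atTop (nhds 0) := by
    refine hexp.zero_mul_isBoundedUnder_le ⟨C, ?_⟩
    rw [Filter.eventually_map]
    filter_upwards [Filter.Ioi_mem_atTop xr] with t ht using hC t ht
  have hlim := ((hexp.mul hexp).mul_const (Complex.exp (-k * x) * (W' x + k * W x))).sub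
    (hWexp.const_mul (2 * k))
  have hconst : Complex.exp (k * x) * (W' x - k * W x) = 0 := by
    refine tendsto_nhds_unique (tendsto_const_nhds.congr' ?_) (by simpa using hlim)
    filter_upwards [Filter.Ioi_mem_atTop xr] with t ht
    have h1 := exp_neg_mul_mul_eq_of_hasDerivAt_mul hV hx ht
    have h2 := exp_neg_mul_mul_eq_of_hasDerivAt_mul hU hx ht
    have h3 : Complex.exp (k * t) * Complex.exp (-k * t) = 1 := by
      rw [← Complex.exp_add]; simp
    simp only [neg_neg] at h1
    simp only [neg_mul] at h2 h3 ⊢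
    rw [h1, h2]
    linear_combination (-Complex.exp (k * t) * (W' t + k * W t)) * h3
  exact sub_eq_zero.mp ((mul_eq_zero.mp hconst).resolve_left (Complex.exp_ne_zero _))
end

section
/- Let x₊ ∈ ℝ and let f be a Schwartz function on ℝ with f(x) = 0 for all x ≥ x₊. Define u(x,t) = (1/2π) ∫_ℝ e^{i(ζx − ζ²t)} f̂(ζ) dζ, where f̂(ζ) = ∫_ℝ f(x) e^{−iζx} dx; then u solves the free Schrödinger equation i∂_t u + ∂_x² u = 0 with u(·,0) = f. For every t > 0 the solution satisfies the exact transparent boundary condition at x₊: ∂_x u(x₊, t) + e^{−iπ/4} · d/dt [ (1/√π) ∫₀ᵗ (t−s)^{−1/2} u(x₊, s) ds ] = 0. -/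
open MeasureTheory Real

/-- The superposition `∫ e^{i(ζx - ζ²t)} h(ζ) dζ` of Schrödinger plane waves. -/
noncomputable def planeWaveIntegral (h : ℝ → ℂ) (x t : ℝ) : ℂ :=
  ∫ ζ : ℝ, Complex.exp (Complex.I * (ζ * x - ζ ^ 2 * t)) * h ζ

theorem norm_planeWave (ζ x t : ℝ) :
    ‖Complex.exp (Complex.I * (ζ * x - ζ ^ 2 * t))‖ = 1 := by
  have := Complex.norm_exp_I_mul_ofReal (ζ * x - ζ ^ 2 * t)
  push_cast at this
  exact this

theorem norm_planeWaveIntegral_le (h : ℝ → ℂ) (x t : ℝ) :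
    ‖planeWaveIntegral h x t‖ ≤ ∫ ζ, ‖h ζ‖ := by
  refine (norm_integral_le_integral_norm _).trans_eq ?_
  simp [norm_planeWave]

theorem continuous_planeWaveIntegral {h : ℝ → ℂ} (hh : Integrable h) (x : ℝ) :
    Continuous (planeWaveIntegral h x) := by
  refine continuous_of_dominated (bound := fun ζ => ‖h ζ‖) (fun t => ?_) (fun t => ?_) hh.norm ?_
  · exact (Continuous.aestronglyMeasurable (by fun_prop)).mul hh.aestronglyMeasurable
  · exact .of_forall fun ζ => by simp [norm_planeWave]
  · exact .of_forall fun ζ => by fun_prop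

theorem hasDerivAt_planeWaveIntegral_fst {h : ℝ → ℂ} (hh : Integrable h)
    (hh1 : Integrable fun ζ : ℝ => Complex.I * ζ * h ζ) (x t : ℝ) :
    HasDerivAt (fun x' => planeWaveIntegral h x' t)
      (planeWaveIntegral (fun ζ => Complex.I * ζ * h ζ) x t) x := by
  refine (hasDerivAt_integral_of_dominated_loc_of_deriv_le (s := Set.univ)
    (bound := fun ζ => ‖Complex.I * ζ * h ζ‖) (μ := volume)
    (F := fun (x' : ℝ) ζ => Complex.exp (Complex.I * (ζ * x' - ζ ^ 2 * t)) * h ζ)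
    (F' := fun (x' : ℝ) ζ => Complex.exp (Complex.I * (ζ * x' - ζ ^ 2 * t)) * (Complex.I * ζ * h ζ))
    Filter.univ_mem (.of_forall fun x' => ?_) ?_ ?_ ?_ hh1.norm ?_).2
  · exact (Continuous.aestronglyMeasurable (by fun_prop)).mul hh.aestronglyMeasurable
  · refine hh.norm.mono' ((Continuous.aestronglyMeasurable (by fun_prop)).mul
      hh.aestronglyMeasurable) (.of_forall fun ζ => by simp [norm_planeWave])
  · exact (Continuous.aestronglyMeasurable (by fun_prop)).mul hh1.aestronglyMeasurable
  · exact .of_forall fun ζ x' _ => by rw [norm_mul, norm_planeWave, one_mul]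
  · refine .of_forall fun ζ x' _ => ?_
    have h1 : HasDerivAt (fun y : ℝ => Complex.I * ((ζ : ℂ) * y - ζ ^ 2 * t))
        (Complex.I * ((ζ : ℂ) * 1)) x' :=
      (((Complex.ofRealCLM.hasDerivAt (x := x')).const_mul (ζ : ℂ)).sub_const _).const_mul _
    convert! h1.cexp.mul_const (h ζ) using 1
    ring

theorem hasDerivAt_planeWaveIntegral_snd {h : ℝ → ℂ} (hh : Integrable h)
    (hh2 : Integrable fun ζ : ℝ => -(Complex.I * ζ ^ 2) * h ζ) (x t : ℝ) :
    HasDerivAt (planeWaveIntegral h x)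
      (planeWaveIntegral (fun ζ => -(Complex.I * ζ ^ 2) * h ζ) x t) t := by
  refine (hasDerivAt_integral_of_dominated_loc_of_deriv_le (s := Set.univ)
    (bound := fun ζ => ‖-(Complex.I * ζ ^ 2) * h ζ‖) (μ := volume)
    (F := fun (t' : ℝ) ζ => Complex.exp (Complex.I * (ζ * x - ζ ^ 2 * t')) * h ζ)
    (F' := fun (t' : ℝ) ζ =>
      Complex.exp (Complex.I * (ζ * x - ζ ^ 2 * t')) * (-(Complex.I * ζ ^ 2) * h ζ))
    Filter.univ_mem (.of_forall fun x' => ?_) ?_ ?_ ?_ hh2.norm ?_).2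
  · exact (Continuous.aestronglyMeasurable (by fun_prop)).mul hh.aestronglyMeasurable
  · refine hh.norm.mono' ((Continuous.aestronglyMeasurable (by fun_prop)).mul
      hh.aestronglyMeasurable) (.of_forall fun ζ => by simp [norm_planeWave])
  · exact (Continuous.aestronglyMeasurable (by fun_prop)).mul hh2.aestronglyMeasurable
  · exact .of_forall fun ζ x' _ => by rw [norm_mul, norm_planeWave, one_mul]
  · refine .of_forall fun ζ x' _ => ?_
    have h1 : HasDerivAt (fun y : ℝ => Complex.I * ((ζ : ℂ) * x - ζ ^ 2 * y))
        (Complex.I * (-((ζ : ℂ) ^ 2 * 1))) x' :=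
      (((Complex.ofRealCLM.hasDerivAt (x := x')).const_mul ((ζ : ℂ) ^ 2)).const_sub _).const_mul _
    convert! h1.cexp.mul_const (h ζ) using 1
    ring

/-- Laplace transform of a superposition of oscillating exponentials. -/
theorem integral_Ioi_exp_mul_integral {k : ℝ → ℂ} (hk : Integrable k) {φ : ℝ → ℝ}
    (hφ : Continuous φ) {a : ℂ} (ha : 0 < a.re) :
    ∫ s in Set.Ioi (0 : ℝ), Complex.exp (-a * s) * ∫ ζ, Complex.exp (-(Complex.I * φ ζ * s)) * k ζ
      = ∫ ζ, k ζ / (a + Complex.I * φ ζ) := by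
  simp_rw [← integral_const_mul]
  rw [integral_integral_swap]
  · congr 1 with ζ
    have h1 : (-(a + Complex.I * φ ζ)).re < 0 := by simpa using ha
    have h2 := integral_exp_mul_complex_Ioi h1 0
    calc _ = ∫ s in Set.Ioi (0 : ℝ), Complex.exp (-(a + Complex.I * φ ζ) * s) * k ζ := by
          congr 1 with s
          rw [← mul_assoc, ← Complex.exp_add]
          ring_nf
      _ = _ := by
          rw [integral_mul_const, h2]
          simp only [Complex.ofReal_zero, mul_zero, Complex.exp_zero]
          rw [neg_div_neg_eq]
          ring
  · have hb : Integrable (fun z : ℝ × ℝ => Complex.exp (-a * z.1) * k z.2)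
        ((volume.restrict (Set.Ioi (0 : ℝ))).prod volume) :=
      Integrable.mul_prod (integrableOn_exp_mul_complex_Ioi (by simpa using ha) 0) hk
    refine hb.mono ?_ (.of_forall fun z => ?_)
    · exact (Continuous.aestronglyMeasurable (by fun_prop)).mul
        ((Continuous.aestronglyMeasurable (by fun_prop)).mul hk.aestronglyMeasurable.comp_snd)
    · have : ‖Complex.exp (-(Complex.I * φ z.2 * z.1))‖ = 1 := by
        rw [Complex.norm_exp]; simp
      simp only [Function.uncurry, norm_mul, this, one_mul, le_refl]

theorem eq_zero_of_fourier_eq_zero {g : ℝ → ℂ} (hc : Continuous g) (hi : Integrable g)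
    (h0 : ∀ η, FourierTransform.fourier g η = 0) : g = 0 := by
  have h0' : FourierTransform.fourier g = 0 := funext h0
  have := hc.fourierInv_fourier_eq hi (by rw [h0']; exact integrable_zero _ _ _)
  rw [← this, h0']
  ext x
  simp [Real.fourierInv_eq]

/-- The half-line Laplace transform of `t^{-1/2}`. -/
theorem integral_Ioi_exp_mul_rpow_neg_half {p : ℂ} (hp : 0 < p.re) :
    ∫ t in Set.Ioi (0 : ℝ), Complex.exp (-p * t) * ((t ^ (-(1 / 2) : ℝ) : ℝ) : ℂ)
      = (π / p) ^ (1 / 2 : ℂ) := by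
  rw [← integral_comp_rpow_Ioi_of_pos (p := 2) two_pos]
  have h := integral_gaussian_complex_Ioi hp
  calc _ = ∫ x in Set.Ioi (0 : ℝ), 2 * Complex.exp (-p * x ^ 2) := by
        refine setIntegral_congr_fun measurableSet_Ioi fun x hx => ?_
        have hx : 0 < x := hx
        have h1 : ((x ^ 2) ^ (-(1 / 2) : ℝ) : ℝ) = x⁻¹ := by
          rw [← rpow_two, ← rpow_mul hx.le]; norm_num [rpow_neg_one]
        have h2 : (x : ℂ) ≠ 0 := by exact_mod_cast hx.ne'
        have h3 : (2 - 1 : ℝ) = 1 := by norm_num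
        simp only [h3, rpow_one, rpow_two, h1, Complex.real_smul]
        push_cast
        field_simp
    _ = _ := by rw [integral_const_mul, h]; ring

theorem integrable_div_add_I_mul {k : ℝ → ℂ} (hk : Integrable k) {φ : ℝ → ℝ}
    (hφ : Continuous φ) {a : ℂ} (ha : 0 < a.re) :
    Integrable fun ζ => k ζ / (a + Complex.I * φ ζ) := by
  have hre (ζ : ℝ) : a.re ≤ ‖a + Complex.I * φ ζ‖ := by
    refine le_trans (le_of_eq ?_) (Complex.re_le_norm _)
    simp
  have hne (ζ : ℝ) : a + Complex.I * φ ζ ≠ 0 := norm_pos_iff.mp (ha.trans_le (hre ζ))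
  have hc : Continuous fun ζ => (a + Complex.I * φ ζ)⁻¹ :=
    Continuous.inv₀ (by fun_prop) hne
  simp_rw [div_eq_mul_inv]
  refine hk.mul_bdd (c := a.re⁻¹) hc.aestronglyMeasurable (.of_forall fun ζ => ?_)
  rw [norm_inv]
  exact inv_anti₀ ha (hre ζ)

/-- If the wave vanishes initially to the right of `x`, then the Laplace transforms in time of
its value and of its derivative at `x` differ by the factor `-μ`, where `μ² = -ip`. -/
theorem laplace_planeWaveIntegral_deriv {h : ℝ → ℂ} (hh : Integrable h)
    (hh1 : Integrable fun ζ : ℝ => Complex.I * ζ * h ζ) {x : ℝ}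
    (hvan : ∀ y, x ≤ y → planeWaveIntegral h y 0 = 0) {p μ : ℂ} (hp : 0 < p.re)
    (hμ : 0 < μ.re) (hμp : μ ^ 2 = -(Complex.I * p)) :
    ∫ t in Set.Ioi (0 : ℝ),
        Complex.exp (-p * t) * planeWaveIntegral (fun ζ => Complex.I * ζ * h ζ) x t
      = -μ * ∫ t in Set.Ioi (0 : ℝ), Complex.exp (-p * t) * planeWaveIntegral h x t := by
  have hmod {k : ℝ → ℂ} (hk : Integrable k) :
      Integrable fun ζ : ℝ => Complex.exp (Complex.I * (ζ * x)) * k ζ := by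
    refine hk.norm.mono' ((Continuous.aestronglyMeasurable (by fun_prop)).mul
      hk.aestronglyMeasurable) (.of_forall fun ζ => ?_)
    have := norm_planeWave ζ x 0
    simp only [Complex.ofReal_zero, mul_zero, sub_zero] at this
    rw [norm_mul, this, one_mul]
  have hL {k : ℝ → ℂ} (hk : Integrable k) :
      ∫ t in Set.Ioi (0 : ℝ), Complex.exp (-p * t) * planeWaveIntegral k x t
        = ∫ ζ : ℝ, Complex.exp (Complex.I * (ζ * x)) * k ζ /
            (p + Complex.I * ((ζ ^ 2 : ℝ) : ℂ)) := by
    rw [← integral_Ioi_exp_mul_integral (hmod hk) (by fun_prop) hp]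
    congr 1 with t
    congr 1
    refine integral_congr_ae (.of_forall fun ζ => ?_)
    dsimp only
    rw [← mul_assoc, ← Complex.exp_add]
    push_cast
    ring_nf
  have hz : ∫ ζ : ℝ, Complex.exp (Complex.I * (ζ * x)) * h ζ /
      (μ + Complex.I * ((-ζ : ℝ) : ℂ)) = 0 := by
    rw [← integral_Ioi_exp_mul_integral (hmod hh) (by fun_prop) hμ]
    refine setIntegral_eq_zero_of_forall_eq_zero fun s hs => ?_
    rw [mul_eq_zero]
    right
    rw [← hvan (x + s) (by linarith [Set.mem_Ioi.mp hs])]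
    congr 1 with ζ
    rw [← mul_assoc, ← Complex.exp_add]
    push_cast
    ring_nf
  rw [hL hh, hL hh1, ← integral_const_mul, ← sub_eq_zero, ← integral_sub
    (integrable_div_add_I_mul (hmod hh1) (by fun_prop) hp)
    ((integrable_div_add_I_mul (hmod hh) (by fun_prop) hp).const_mul _)]
  rw [← mul_zero (-Complex.I), ← hz, ← integral_const_mul]
  congr 1 with ζ
  have h1 : μ + Complex.I * ((-ζ : ℝ) : ℂ) ≠ 0 := fun h0 => by
    have := congrArg Complex.re h0
    simp at this
    exact hμ.ne' this
  have h2 : p + Complex.I * ((ζ ^ 2 : ℝ) : ℂ) ≠ 0 := fun h0 => by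
    have := congrArg Complex.re h0
    rw [Complex.add_re, Complex.re_mul_ofReal, Complex.I_re] at this
    simp at this
    exact hp.ne' this
  push_cast at h1 h2 ⊢
  rw [mul_neg, ← sub_eq_add_neg] at h1 ⊢
  field_simp
  linear_combination h ζ * (hμp - ζ ^ 2 * Complex.I_sq + ζ ^ 2 * Complex.I_sq)

/-- The extension by zero to negative times of `t ↦ e^{-t} v(t)`. -/
noncomputable def dampedCausal (v : ℝ → ℂ) : ℝ → ℂ :=
  (Set.Ioi (0 : ℝ)).indicator fun t => Complex.exp (-t) * v t

theorem continuous_dampedCausal {v : ℝ → ℂ} (hv : Continuous v) (h0 : v 0 = 0) :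
    Continuous (dampedCausal v) := by
  refine continuous_indicator (fun a ha => ?_) (by fun_prop)
  rw [frontier_Ioi, Set.mem_singleton_iff] at ha
  simp [ha, h0]

theorem norm_dampedCausal_le {v : ℝ → ℂ} {C : ℝ} (hC : ∀ t, ‖v t‖ ≤ C) (t : ℝ) :
    ‖dampedCausal v t‖ ≤ C := by
  unfold dampedCausal
  rw [Set.indicator_apply]
  split_ifs with ht
  · have ht : 0 < t := ht
    rw [norm_mul, Complex.norm_exp]
    have : rexp (-t) ≤ 1 := by simpa using ht.le
    simp only [Complex.neg_re, Complex.ofReal_re]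
    exact (mul_le_of_le_one_left (norm_nonneg _) this).trans (hC t)
  · simpa using (norm_nonneg _).trans (hC t)

theorem integrable_dampedCausal {v : ℝ → ℂ} (hv : Continuous v) {C : ℝ} (hC : ∀ t, ‖v t‖ ≤ C) :
    Integrable (dampedCausal v) := by
  refine (IntegrableOn.integrable_indicator ?_ measurableSet_Ioi)
  have := integrableOn_exp_mul_complex_Ioi (a := -1) (by simp) 0
  refine (this.mul_bdd (c := C) hv.aestronglyMeasurable (.of_forall hC)).congr ?_
  exact .of_forall fun t => by simp

theorem fourier_dampedCausal (v : ℝ → ℂ) (η : ℝ) :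
    FourierTransform.fourier (dampedCausal v) η
      = ∫ t in Set.Ioi (0 : ℝ), Complex.exp (-(1 + 2 * π * η * Complex.I) * t) * v t := by
  rw [Real.fourier_real_eq_integral_exp_smul, ← integral_indicator measurableSet_Ioi]
  congr 1 with t
  unfold dampedCausal
  by_cases ht : t ∈ Set.Ioi (0 : ℝ)
  · simp only [Set.indicator_of_mem ht, smul_eq_mul]
    rw [← mul_assoc, ← Complex.exp_add]
    push_cast
    ring_nf
  · simp [Set.indicator_of_notMem ht]

theorem convolution_dampedCausal (k v : ℝ → ℂ) {t : ℝ} (ht : 0 < t) :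
    (convolution (dampedCausal k) (dampedCausal v) (ContinuousLinearMap.mul ℂ ℂ)) t
      = Complex.exp (-t) * ∫ s in (0 : ℝ)..t, k (t - s) * v s := by
  rw [convolution_eq_swap, intervalIntegral.integral_of_le ht.le, integral_Ioc_eq_integral_Ioo,
    ← integral_indicator measurableSet_Ioo, ← integral_const_mul]
  congr 1 with s
  simp only [dampedCausal, ContinuousLinearMap.mul_apply', Set.indicator_apply, Set.mem_Ioi,
    Set.mem_Ioo, sub_pos]
  by_cases h1 : s < t <;> by_cases h2 : 0 < s <;> simp [h1, h2]
  rw [show (-(t : ℂ)) = -(t - s) + -s by ring, Complex.exp_add]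
  simp
  ring

/-- A solution `(v, w)` of `ŵ = -√(-ip) v̂` in Laplace variables has the half-integral of `v`
proportional to the integral of `w`. -/
theorem integral_rpow_neg_half_mul_eq {v w : ℝ → ℂ} (hv : Continuous v) (hw : Continuous w)
    (hv0 : v 0 = 0) (hw0 : w 0 = 0) {C D : ℝ} (hC : ∀ t, ‖v t‖ ≤ C) (hD : ∀ t, ‖w t‖ ≤ D)
    (hL : ∀ p μ : ℂ, 0 < p.re → 0 < μ.re → μ ^ 2 = -(Complex.I * p) →
      ∫ t in Set.Ioi (0 : ℝ), Complex.exp (-p * t) * w t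
        = -μ * ∫ t in Set.Ioi (0 : ℝ), Complex.exp (-p * t) * v t) {t : ℝ} (ht : 0 < t) :
    ∫ s in (0 : ℝ)..t, (((t - s) ^ (-(1 / 2) : ℝ) : ℝ) : ℂ) * v s
      = -((√π : ℂ) * Complex.exp (Complex.I * (π / 4 : ℝ))) * ∫ s in (0 : ℝ)..t, w s := by
  set k : ℝ → ℂ := fun t => ((t ^ (-(1 / 2) : ℝ) : ℝ) : ℂ)
  set c : ℂ := (√π : ℂ) * Complex.exp (Complex.I * (π / 4 : ℝ)) with hc
  set d : ℂ := (√π : ℂ) * Complex.exp (-(Complex.I * (π / 4 : ℝ))) with hd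
  have hpi : ((√π : ℝ) : ℂ) ^ 2 = π := by
    rw [← Complex.ofReal_pow, Real.sq_sqrt pi_pos.le]
  have hcd : c * d = π := by
    rw [hc, hd, mul_mul_mul_comm, ← Complex.exp_add, add_neg_cancel, Complex.exp_zero, ← hpi]
    ring
  have hd2 : d ^ 2 = -(Complex.I * π) := by
    rw [hd, mul_pow, hpi, ← Complex.exp_nat_mul,
      show ((2 : ℕ) : ℂ) * -(Complex.I * (π / 4 : ℝ)) = -(π / 2 * Complex.I) by
        push_cast; ring, Complex.exp_neg, Complex.exp_pi_div_two_mul_I, Complex.inv_I]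
    ring
  have hdre : d.re = √π * (√2 / 2) ∧ d.im = -(√π * (√2 / 2)) := by
    have : d = (√π : ℂ) * Complex.exp (((-(π / 4) : ℝ) : ℂ) * Complex.I) := by
      rw [hd]; push_cast; ring_nf
    rw [this, Complex.re_ofReal_mul, Complex.im_ofReal_mul, Complex.exp_ofReal_mul_I_re,
      Complex.exp_ofReal_mul_I_im, Real.cos_neg, Real.sin_neg, Real.cos_pi_div_four,
      Real.sin_pi_div_four]
    simp
  have hK : Integrable (dampedCausal k) := by
    refine IntegrableOn.integrable_indicator ?_ measurableSet_Ioi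
    have := (Real.GammaIntegral_convergent (s := 1 / 2) (by norm_num)).ofReal (𝕜 := ℂ)
    refine IntegrableOn.congr_fun this (fun t _ => ?_) measurableSet_Ioi
    norm_num [k]
  have hE : Integrable (dampedCausal fun _ => 1) :=
    integrable_dampedCausal continuous_const (C := 1) (by simp)
  have hV := integrable_dampedCausal hv hC
  have hW := integrable_dampedCausal hw hD
  have hbdd {g : ℝ → ℂ} {B : ℝ} (hg : ∀ t, ‖g t‖ ≤ B) :
      BddAbove (Set.range fun t => ‖dampedCausal g t‖) :=
    ⟨B, by rintro _ ⟨t, rfl⟩; exact norm_dampedCausal_le hg t⟩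
  let L := ContinuousLinearMap.mul ℂ ℂ
  have hKV := hK.integrable_convolution L hV
  have hEW := hE.integrable_convolution L hW
  have hG : convolution (dampedCausal k) (dampedCausal v) L +
      c • convolution (dampedCausal fun _ => 1) (dampedCausal w) L = 0 := by
    refine eq_zero_of_fourier_eq_zero ?_ (hKV.add (hEW.smul c)) fun η => ?_
    · exact ((hbdd hC).continuous_convolution_right_of_integrable L hK
        (continuous_dampedCausal hv hv0)).add
        (((hbdd hD).continuous_convolution_right_of_integrable L hE
        (continuous_dampedCausal hw hw0)).const_smul c)
    · have hadd : FourierTransform.fourier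
          (convolution (dampedCausal k) (dampedCausal v) L +
            c • convolution (dampedCausal fun _ => 1) (dampedCausal w) L) η
          = FourierTransform.fourier (convolution (dampedCausal k) (dampedCausal v) L) η +
            c * FourierTransform.fourier
              (convolution (dampedCausal fun _ => 1) (dampedCausal w) L) η := by
        have h1 := VectorFourier.fourierIntegral_add (μ := volume) (V := ℝ) (W := ℝ)
          Real.continuous_fourierChar (L := innerₗ ℝ) (by fun_prop) hKV (hEW.smul c)
        have h2 := VectorFourier.fourierIntegral_const_smul (V := ℝ) (W := ℝ) Real.fourierChar
          volume (innerₗ ℝ) (convolution (dampedCausal fun _ => 1) (dampedCausal w) L) c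
        rw [h2] at h1
        exact congrFun h1 η
      rw [hadd, Real.fourier_mul_convolution_eq hK hV, Real.fourier_mul_convolution_eq hE hW]
      simp only [fourier_dampedCausal]
      set p : ℂ := 1 + 2 * π * η * Complex.I
      have hp : 0 < p.re := by simp [p]
      have hp0 : p ≠ 0 := fun h => by simp [h] at hp
      have hone : ∫ t in Set.Ioi (0 : ℝ), Complex.exp (-p * t) * 1 = 1 / p := by
        simp_rw [mul_one]
        rw [integral_exp_mul_complex_Ioi (by simpa using hp)]
        simp [neg_div_neg_eq]
      rw [integral_Ioi_exp_mul_rpow_neg_half hp, hone]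
      set q : ℂ := (π / p) ^ (1 / 2 : ℂ) with hq
      have hq2 : q ^ 2 = π / p := by
        rw [hq, one_div]
        exact Complex.cpow_nat_inv_pow _ two_ne_zero
      have hq0 : q ≠ 0 := by
        rintro h
        rw [h] at hq2
        have : (π : ℂ) / p ≠ 0 := div_ne_zero (by exact_mod_cast pi_ne_zero) hp0
        exact this (by rw [← hq2]; ring)
      have hzre : 0 < ((π : ℂ) / p).re := by
        rw [Complex.div_re]
        simp only [Complex.ofReal_re, Complex.ofReal_im, zero_mul, zero_div, add_zero]
        have := Complex.normSq_pos.mpr hp0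
        have := pi_pos
        positivity
      have hqre : 0 ≤ q.re := by
        rw [hq, one_div, Complex.cpow_inv_two_re]
        positivity
      have hqlt : q.im < q.re := by
        refine lt_of_abs_lt (abs_lt_of_sq_lt_sq ?_ hqre)
        rw [← hq2, pow_two, Complex.mul_re] at hzre
        linarith
      have hμ : 0 < (d / q).re := by
        rw [Complex.div_re, hdre.1, hdre.2, ← add_div]
        refine div_pos ?_ (Complex.normSq_pos.mpr hq0)
        have : 0 < √π * (√2 / 2) := by have := pi_pos; positivity
        nlinarith
      rw [hL p (d / q) hp hμ (by rw [div_pow, hd2, hq2]; field_simp)]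
      have hqp : q ^ 2 * p = π := by rw [hq2]; field_simp
      generalize ∫ t in Set.Ioi (0 : ℝ), Complex.exp (-p * t) * v t = J
      clear_value c d p q
      field_simp
      linear_combination J * (hqp - hcd)
  have := congrFun hG t
  simp only [Pi.add_apply, Pi.smul_apply, Pi.zero_apply, smul_eq_mul, L] at this
  rw [convolution_dampedCausal _ _ ht, convolution_dampedCausal _ _ ht] at this
  simp only [one_mul] at this
  have he := Complex.exp_ne_zero (-(t : ℂ))
  refine mul_left_cancel₀ he ?_
  linear_combination this

/-- Exact transparent boundary condition at `xp` for the 1D free Schrödinger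
equation with Schwartz initial data supported to the left of `xp`. -/
theorem schrodinger_1d_transparent_boundary_condition
    (xp : ℝ) (f : SchwartzMap ℝ ℂ)
    (hsupp : ∀ x : ℝ, xp ≤ x → f x = 0)
    (fhat : ℝ → ℂ)
    (hfhat : ∀ ζ : ℝ, fhat ζ = ∫ x : ℝ, f x * Complex.exp (-(Complex.I * ζ * x)))
    (u : ℝ → ℝ → ℂ)
    (hu : ∀ x t : ℝ, u x t =
      (1 / (2 * (π : ℂ))) * ∫ ζ : ℝ, Complex.exp (Complex.I * (ζ * x - ζ^2 * t)) * fhat ζ) :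
    (∀ x t : ℝ,
      Complex.I * deriv (fun t' => u x t') t + deriv (deriv (fun x' => u x' t)) x = 0) ∧
    (∀ x : ℝ, u x 0 = f x) ∧
    (∀ t : ℝ, 0 < t →
      deriv (fun x' => u x' t) xp +
        Complex.exp (-(Complex.I * (π / 4 : ℝ))) *
          deriv (fun t' => (1 / (Real.sqrt π : ℂ)) *
            ∫ s in (0:ℝ)..t', Complex.ofReal ((t' - s) ^ (-(1/2) : ℝ)) * u xp s) t = 0) := by
  have hpi0 : (2 * (π : ℂ)) ≠ 0 := by simp [pi_ne_zero]
  have hpi2 : (0 : ℝ) < 2 * π := by positivity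
  replace hu : ∀ x t : ℝ, u x t = (1 / (2 * (π : ℂ))) * planeWaveIntegral fhat x t := hu
  have hfF : ∀ ζ, fhat ζ = FourierTransform.fourier f (ζ / (2 * π)) := fun ζ => by
    rw [hfhat, SchwartzMap.fourier_coe, Real.fourier_real_eq_integral_exp_smul]
    congr 1 with x
    rw [smul_eq_mul, mul_comm]
    congr 2
    push_cast
    field_simp
  have hint (n : ℕ) : Integrable fun ζ : ℝ => (ζ : ℂ) ^ n * fhat ζ := by
    have h1 : Integrable fun ξ : ℝ => (ξ : ℂ) ^ n * FourierTransform.fourier f ξ := by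
      refine ((FourierTransform.fourier f).integrable_pow_mul volume n).mono
        (Continuous.aestronglyMeasurable (by fun_prop)) (.of_forall fun ξ => ?_)
      simp
    refine ((h1.comp_div hpi2.ne').const_mul ((2 * π : ℂ) ^ n)).congr (.of_forall fun ζ => ?_)
    simp only [hfF]
    push_cast
    rw [← mul_assoc, ← mul_pow, mul_div_cancel₀ _ hpi0]
  have h0 : Integrable fhat := by simpa using hint 0
  have h1 : Integrable fun ζ : ℝ => Complex.I * ζ * fhat ζ := by
    simpa [mul_assoc] using (hint 1).const_mul Complex.I
  have h2 : Integrable fun ζ : ℝ => Complex.I * ζ * (Complex.I * ζ * fhat ζ) := by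
    refine ((hint 2).const_mul (Complex.I ^ 2)).congr (.of_forall fun ζ => ?_)
    dsimp only
    ring
  have h2' : Integrable fun ζ : ℝ => -(Complex.I * ζ ^ 2) * fhat ζ := by
    simpa [mul_assoc] using (hint 2).const_mul (-Complex.I)
  have hinv : ∀ x, planeWaveIntegral fhat x 0 = 2 * π * f x := fun x => by
    have hF : FourierTransformInv.fourierInv (FourierTransform.fourier (f : ℝ → ℂ)) = f :=
      f.continuous.fourierInv_fourier_eq f.integrable
        (by rw [← SchwartzMap.fourier_coe]; exact SchwartzMap.integrable _)
    have h3 := Measure.integral_comp_div (fun ξ : ℝ =>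
      Complex.exp (((2 * π * (ξ * x) : ℝ) : ℂ) * Complex.I) •
        FourierTransform.fourier (f : ℝ → ℂ) ξ) (2 * π)
    rw [← congrFun hF x, Real.fourierInv_eq']
    simp only [RCLike.inner_apply, conj_trivial]
    rw [abs_of_pos hpi2, Complex.real_smul] at h3
    push_cast at h3
    simp_rw [mul_comm x]
    push_cast
    rw [← h3]
    refine integral_congr_ae (.of_forall fun ζ => ?_)
    simp only [hfF, SchwartzMap.fourier_coe, smul_eq_mul]
    congr 2
    push_cast
    field_simp
    simp
  have hdx : ∀ x t, HasDerivAt (fun x' => u x' t) ((1 / (2 * (π : ℂ))) *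
      planeWaveIntegral (fun ζ => Complex.I * ζ * fhat ζ) x t) x := fun x t => by
    simp_rw [hu]
    exact (hasDerivAt_planeWaveIntegral_fst h0 h1 x t).const_mul _
  refine ⟨fun x t => ?_, fun x => ?_, fun t ht => ?_⟩
  · have h3 : deriv (fun x' => u x' t) = fun x => (1 / (2 * (π : ℂ))) *
        planeWaveIntegral (fun ζ => Complex.I * ζ * fhat ζ) x t :=
      funext fun x => (hdx x t).deriv
    have h4 : HasDerivAt (fun t' => u x t') ((1 / (2 * (π : ℂ))) *
        planeWaveIntegral (fun ζ => -(Complex.I * ζ ^ 2) * fhat ζ) x t) t := by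
      simp_rw [hu]
      exact (hasDerivAt_planeWaveIntegral_snd h0 h2' x t).const_mul _
    rw [h3, ((hasDerivAt_planeWaveIntegral_fst h1 h2 x t).const_mul _).deriv, h4.deriv]
    have h5 : planeWaveIntegral (fun ζ => Complex.I * ζ * (Complex.I * ζ * fhat ζ)) x t
        = -Complex.I * planeWaveIntegral (fun ζ => -(Complex.I * ζ ^ 2) * fhat ζ) x t := by
      unfold planeWaveIntegral
      rw [← integral_const_mul]
      congr 1 with ζ
      ring
    rw [h5]
    ring
  · rw [hu, hinv]
    field_simp
  · set v := planeWaveIntegral fhat xp with hv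
    set w := planeWaveIntegral (fun ζ => Complex.I * ζ * fhat ζ) xp with hw
    have hvan : ∀ y, xp ≤ y → planeWaveIntegral fhat y 0 = 0 := fun y hy => by
      rw [hinv, hsupp y hy, mul_zero]
    have hw0 : w 0 = 0 := by
      have h3 := (hasDerivAt_planeWaveIntegral_fst h0 h1 xp 0).hasDerivWithinAt (s := Set.Ici xp)
      have h4 : HasDerivWithinAt (fun x' => planeWaveIntegral fhat x' 0) 0 (Set.Ici xp) xp :=
        (hasDerivWithinAt_const xp _ (0 : ℂ)).congr (fun y hy => hvan y hy) (hvan xp le_rfl)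
      exact (uniqueDiffWithinAt_Ici xp).eq_deriv _ h3 h4
    have hwc : Continuous w := continuous_planeWaveIntegral h1 xp
    have hhalf {t : ℝ} (ht : 0 < t) := integral_rpow_neg_half_mul_eq
      (continuous_planeWaveIntegral h0 xp) hwc (hvan xp le_rfl) hw0
      (norm_planeWaveIntegral_le _ xp) (norm_planeWaveIntegral_le _ xp)
      (fun p μ hp hμ hμp => laplace_planeWaveIntegral_deriv h0 h1 hvan hp hμ hμp) ht
    have hsq : (√π : ℂ) ≠ 0 := by
      exact_mod_cast (Real.sqrt_pos.mpr pi_pos).ne'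
    have hF : HasDerivAt (fun t' => (1 / (√π : ℂ)) *
        ∫ s in (0:ℝ)..t', Complex.ofReal ((t' - s) ^ (-(1/2) : ℝ)) * u xp s)
        (-Complex.exp (Complex.I * (π / 4 : ℝ)) / (2 * π) * w t) t := by
      refine (((intervalIntegral.integral_hasDerivAt_right (hwc.intervalIntegrable 0 t)
        (hwc.stronglyMeasurableAtFilter _ _) hwc.continuousAt).const_mul _)).congr_of_eventuallyEq ?_
      filter_upwards [lt_mem_nhds ht] with t' ht'
      have h3 : ∫ s in (0:ℝ)..t', Complex.ofReal ((t' - s) ^ (-(1/2) : ℝ)) * u xp s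
          = (1 / (2 * (π : ℂ))) *
            ∫ s in (0:ℝ)..t', Complex.ofReal ((t' - s) ^ (-(1/2) : ℝ)) * v s := by
        rw [← intervalIntegral.integral_const_mul]
        congr 1 with s
        rw [hu]
        ring
      rw [h3, hhalf ht']
      field_simp
    rw [(hdx xp t).deriv, hF.deriv, Complex.exp_neg]
    have := Complex.exp_ne_zero (Complex.I * (π / 4 : ℝ))
    field_simp
    ring
end

section
/- Let u₀ be a Schwartz function on ℝ² and let x_b < x_t be real numbers such that u₀(x₁,x₂) = 0 whenever x₂ ∉ [x_b, x_t]. Define the auxiliary function φ(x₁,x₂,τ₁,τ₂) = (1/4π²) ∫_{ℝ²} e^{i(ζ₁x₁+ζ₂x₂) − iζ₁²τ₁ − iζ₂²τ₂} û₀(ζ₁,ζ₂) dζ₁dζ₂, where û₀ is the two-dimensional Fourier transform of u₀. Then for every x₁ ∈ ℝ, every τ₁ ∈ ℝ and every x₂ ∉ [x_b, x_t], one has φ(x₁, x₂, τ₁, 0) = 0; that is, the support of x₂ ↦ φ(x₁,x₂,τ₁,0) is contained in [x_b,x_t]. -/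
open MeasureTheory Real

/-- Fourier inversion in the angular-frequency normalization, at a zero of `g`. No integrability
of the transform is needed, since otherwise the outer integral is zero by convention. -/
theorem integral_exp_mul_fourierIntegral_eq_zero {g : ℝ → ℂ} (hg : Integrable g) {x : ℝ}
    (hc : ContinuousAt g x) (hx : g x = 0) :
    ∫ w : ℝ, Complex.exp (Complex.I * (w * x)) *
      ∫ y : ℝ, g y * Complex.exp (-(Complex.I * (w * y))) = 0 := by
  have hscale : ∀ w : ℝ, Complex.exp (Complex.I * (w * x)) *
      ∫ y : ℝ, g y * Complex.exp (-(Complex.I * (w * y))) =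
      (fun v : ℝ => Complex.exp (↑(2 * π * (v * x)) * Complex.I) *
        FourierTransform.fourier g v) (w / (2 * π)) := by
    intro w
    have hpi : (π : ℂ) ≠ 0 := by exact_mod_cast pi_ne_zero
    simp only [Real.fourier_eq', smul_eq_mul]
    congr 1
    · congr 1
      push_cast
      field_simp
    · refine integral_congr_ae (Filter.Eventually.of_forall fun y => ?_)
      simp only [RCLike.inner_apply, conj_trivial]
      rw [mul_comm]
      congr 2
      push_cast
      field_simp
  rw [integral_congr_ae (Filter.Eventually.of_forall hscale), Measure.integral_comp_div
    (fun v : ℝ => Complex.exp (↑(2 * π * (v * x)) * Complex.I) * FourierTransform.fourier g v)]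
  by_cases hF : Integrable (FourierTransform.fourier g)
  · have h := hg.fourierInv_fourier_eq hF hc
    rw [Real.fourierInv_eq', hx] at h
    simp only [smul_eq_mul, RCLike.inner_apply, conj_trivial] at h
    simp_rw [mul_comm _ x]
    rw [h, smul_zero]
  · rw [integral_undef, smul_zero]
    intro h
    apply hF
    have hm : Continuous fun v : ℝ => Complex.exp (↑(-(2 * π * (v * x))) * Complex.I) := by
      fun_prop
    refine (h.bdd_mul (c := 1) hm.aestronglyMeasurable
      (Filter.Eventually.of_forall fun v => (Complex.norm_exp_ofReal_mul_I _).le)).congr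
      (Filter.Eventually.of_forall fun v => ?_)
    simp only
    rw [← mul_assoc, ← Complex.exp_add]
    simp

/-- At `τ₂ = 0` the support (with respect to `x₂`) of the auxiliary function
`φ` is contained in `[x_b, x_t]` whenever the initial data vanishes for
`x₂ ∉ [x_b, x_t]`. -/
theorem auxiliary_function_support
    (u₀ : SchwartzMap (ℝ × ℝ) ℂ) (xb xt : ℝ) (hbt : xb < xt)
    (hsupp : ∀ x : ℝ × ℝ, x.2 ∉ Set.Icc xb xt → u₀ x = 0)
    (u₀hat : ℝ × ℝ → ℂ)
    (hhat : ∀ ζ : ℝ × ℝ, u₀hat ζ =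
      ∫ x : ℝ × ℝ, u₀ x * Complex.exp (-(Complex.I * (ζ.1 * x.1 + ζ.2 * x.2))))
    (φ : ℝ → ℝ → ℝ → ℝ → ℂ)
    (hφ : ∀ x₁ x₂ τ₁ τ₂ : ℝ, φ x₁ x₂ τ₁ τ₂ =
      (1 / (4 * (π : ℂ)^2)) * ∫ ζ : ℝ × ℝ,
        Complex.exp (Complex.I * (ζ.1 * x₁ + ζ.2 * x₂)
          - Complex.I * ζ.1^2 * τ₁ - Complex.I * ζ.2^2 * τ₂) * u₀hat ζ) :
    ∀ x₁ τ₁ x₂ : ℝ, x₂ ∉ Set.Icc xb xt → φ x₁ x₂ τ₁ 0 = 0 := by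
  intro x₁ τ₁ x₂ hx₂
  rw [hφ]
  set F : ℝ × ℝ → ℂ := fun ζ => Complex.exp (Complex.I * (ζ.1 * x₁ + ζ.2 * x₂)
    - Complex.I * ζ.1^2 * τ₁ - Complex.I * ζ.2^2 * ((0 : ℝ) : ℂ)) * u₀hat ζ with hF
  suffices h : ∫ ζ, F ζ = 0 by rw [h, mul_zero]
  by_cases hint : Integrable F
  swap
  · exact integral_undef hint
  rw [Measure.volume_eq_prod] at hint ⊢
  rw [integral_prod _ hint]
  refine integral_eq_zero_of_ae (Filter.Eventually.of_forall fun ζ₁ => ?_)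
  set g : ℝ → ℂ := fun y₂ => ∫ y₁ : ℝ, u₀ (y₁, y₂) * Complex.exp (-(Complex.I * (ζ₁ * y₁)))
    with hg
  have hbound : ∀ a : ℝ, Integrable
      (fun x : ℝ × ℝ => u₀ x * Complex.exp (-(Complex.I * (ζ₁ * x.1 + a * x.2))))
      ((volume : Measure ℝ).prod volume) := by
    intro a
    rw [← Measure.volume_eq_prod]
    have hm : Continuous fun x : ℝ × ℝ =>
        Complex.exp (-(Complex.I * (ζ₁ * x.1 + a * x.2))) := by fun_prop
    refine u₀.integrable.mul_bdd (c := 1) hm.aestronglyMeasurable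
      (Filter.Eventually.of_forall fun x => ?_)
    rw [Complex.norm_exp]
    simp
  have hgint : Integrable g := by
    simpa [hg] using (hbound 0).integral_prod_right
  have hgzero : ∀ y, y ∉ Set.Icc xb xt → g y = 0 := by
    intro y hy
    simp [hg, hsupp (_, y) hy]
  have hgc : ContinuousAt g x₂ := by
    refine (continuousAt_const (y := (0 : ℂ))).congr ?_
    filter_upwards [isClosed_Icc.isOpen_compl.mem_nhds hx₂] with y hy
    exact (hgzero y hy).symm
  have hhat' : ∀ ζ₂ : ℝ, u₀hat (ζ₁, ζ₂) =
      ∫ y : ℝ, g y * Complex.exp (-(Complex.I * (ζ₂ * y))) := by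
    intro ζ₂
    rw [hhat, Measure.volume_eq_prod, integral_prod_symm _ (hbound ζ₂)]
    refine integral_congr_ae (Filter.Eventually.of_forall fun y => ?_)
    simp only [hg]
    rw [← integral_mul_const]
    refine integral_congr_ae (Filter.Eventually.of_forall fun z => ?_)
    simp only
    rw [mul_assoc, ← Complex.exp_add]
    ring_nf
  have hfactor : ∀ ζ₂ : ℝ, F (ζ₁, ζ₂) =
      Complex.exp (Complex.I * (ζ₁ * x₁) - Complex.I * ζ₁^2 * τ₁) *
        (Complex.exp (Complex.I * (ζ₂ * x₂)) *
          ∫ y : ℝ, g y * Complex.exp (-(Complex.I * (ζ₂ * y)))) := by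
    intro ζ₂
    rw [← hhat', ← mul_assoc, ← Complex.exp_add]
    simp only [hF]
    congr 2
    push_cast
    ring
  simp_rw [hfactor]
  rw [integral_const_mul,
    integral_exp_mul_fourierIntegral_eq_zero hgint hgc (hgzero x₂ hx₂), mul_zero]
  rfl
end

section
/- Define the Legendre polynomials by Rodrigues' formula L_n(y) = (1/(2ⁿ n!)) dⁿ/dyⁿ (y²−1)ⁿ. Let κ ∈ ℂ be such that κ + (q+2)(q+3)/2 ≠ 0 for all q ∈ ℕ, set b_p = −(κ + p(p+1)/2)/(κ + (p+2)(p+3)/2), and φ_p = L_p + b_p L_{p+2}. Then the stiffness matrix of the boundary-adapted basis is diagonal: for all j, k ∈ ℕ, ∫_{−1}^{1} φ_j(y) φ_k″(y) dy = 2(2k+3) b_k if j = k, and ∫_{−1}^{1} φ_j(y) φ_k″(y) dy = 0 if j ≠ k. -/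
open MeasureTheory

/-- The Legendre polynomial of degree `n`, defined by Rodrigues' formula. -/
noncomputable def legendreP (n : ℕ) (y : ℝ) : ℝ :=
  (1 / (2^n * n.factorial : ℝ)) * iteratedDeriv n (fun z : ℝ => (z^2 - 1)^n) y

open Polynomial

/-- The Legendre polynomial of degree `n` with complex coefficients, as an algebraic object. -/
noncomputable def legendrePoly (n : ℕ) : ℂ[X] :=
  C (1 / (2 ^ n * n.factorial : ℂ)) * derivative^[n] ((X ^ 2 - 1) ^ n)

/-- The iterated derivative of a real polynomial function is given by the iterated formal
derivative. -/
theorem iteratedDeriv_polynomial_eval (n : ℕ) (p : ℝ[X]) :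
    iteratedDeriv n (fun x => p.eval x) = fun x => (derivative^[n] p).eval x := by
  induction n with
  | zero => simp
  | succ n ih =>
    rw [iteratedDeriv_succ, ih, Function.iterate_succ_apply']
    ext x
    exact Polynomial.deriv _

theorem ofReal_legendreP (n : ℕ) (y : ℝ) :
    (legendreP n y : ℂ) = (legendrePoly n).eval (y : ℂ) := by
  have h : (fun z : ℝ => (z ^ 2 - 1) ^ n) = fun z => ((X ^ 2 - 1 : ℝ[X]) ^ n).eval z := by
    ext z
    simp
  have hmap : ((X ^ 2 - 1 : ℂ[X]) ^ n) = ((X ^ 2 - 1 : ℝ[X]) ^ n).map Complex.ofRealHom := by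
    simp
  rw [legendreP, legendrePoly, h, iteratedDeriv_polynomial_eval, hmap, iterate_derivative_map,
    eval_mul, eval_C, ← Complex.ofRealHom_eq_coe y, eval_map_apply]
  simp

theorem hasDerivAt_polynomial_eval_ofReal (p : ℂ[X]) (y : ℝ) :
    HasDerivAt (fun x : ℝ => p.eval (x : ℂ)) (p.derivative.eval (y : ℂ)) y :=
  (p.hasDerivAt (y : ℂ)).comp_ofReal

theorem continuous_polynomial_eval_ofReal (p : ℂ[X]) :
    Continuous fun x : ℝ => p.eval (x : ℂ) :=
  p.continuous.comp Complex.continuous_ofReal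

/-- The integral over `[-1, 1]` as a linear functional on complex polynomials. -/
noncomputable def polyIntegral : ℂ[X] →ₗ[ℂ] ℂ where
  toFun p := ∫ y in (-1 : ℝ)..1, p.eval (y : ℂ)
  map_add' p q := by
    simp only [eval_add]
    exact intervalIntegral.integral_add
      ((continuous_polynomial_eval_ofReal p).intervalIntegrable _ _)
      ((continuous_polynomial_eval_ofReal q).intervalIntegrable _ _)
  map_smul' c p := by
    simp only [eval_smul, smul_eq_mul, intervalIntegral.integral_const_mul, RingHom.id_apply]

theorem polyIntegral_derivative (p : ℂ[X]) :
    polyIntegral (derivative p) = p.eval 1 - p.eval (-1) := by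
  have h := intervalIntegral.integral_eq_sub_of_hasDerivAt
    (fun y _ => hasDerivAt_polynomial_eval_ofReal p y)
    ((continuous_polynomial_eval_ofReal (derivative p)).intervalIntegrable (-1) 1)
  simpa [polyIntegral] using h

theorem polyIntegral_derivative_mul (p q : ℂ[X]) :
    polyIntegral (derivative p * q) =
      p.eval 1 * q.eval 1 - p.eval (-1) * q.eval (-1) - polyIntegral (p * derivative q) := by
  have h := polyIntegral_derivative (p * q)
  rw [derivative_mul, map_add, eval_mul, eval_mul] at h
  linear_combination h

/-- Green's second identity on `[-1, 1]`. -/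
theorem polyIntegral_mul_derivative_derivative (p q : ℂ[X]) :
    polyIntegral (p * derivative (derivative q)) =
      (p.eval 1 * (derivative q).eval 1 - (derivative p).eval 1 * q.eval 1) -
      (p.eval (-1) * (derivative q).eval (-1) - (derivative p).eval (-1) * q.eval (-1)) +
      polyIntegral (q * derivative (derivative p)) := by
  have h₁ := polyIntegral_derivative_mul (derivative q) p
  have h₂ := polyIntegral_derivative_mul (derivative p) q
  rw [mul_comm (derivative (derivative q)) p] at h₁
  rw [mul_comm (derivative (derivative p)) q, mul_comm (derivative p)] at h₂
  linear_combination h₁ - h₂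

theorem eval_iterate_derivative_eq_factorial_mul_coeff_taylor (m : ℕ) (p : ℂ[X]) (r : ℂ) :
    (derivative^[m] p).eval r = m.factorial * (taylor r p).coeff m := by
  rw [taylor_coeff, ← factorial_smul_hasseDeriv]
  simp

theorem taylor_sq_sub_one_pow {r : ℂ} (hr : r ^ 2 = 1) (n : ℕ) :
    taylor r ((X ^ 2 - 1) ^ n) = (X + C (2 * r)) ^ n * X ^ n := by
  have h : (C r : ℂ[X]) ^ 2 = 1 := by rw [← C_pow, hr, C_1]
  rw [taylor_apply, pow_comp, sub_comp, pow_comp, X_comp, one_comp, ← mul_pow, C_mul]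
  congr 1
  simp only [map_ofNat]
  linear_combination h

theorem eval_iterate_derivative_sq_sub_one_pow_of_lt {r : ℂ} (hr : r ^ 2 = 1) {m n : ℕ}
    (hmn : m < n) : (derivative^[m] ((X ^ 2 - 1) ^ n : ℂ[X])).eval r = 0 := by
  rw [eval_iterate_derivative_eq_factorial_mul_coeff_taylor, taylor_sq_sub_one_pow hr,
    coeff_mul_X_pow', if_neg hmn.not_ge, mul_zero]

theorem eval_legendrePoly {r : ℂ} (hr : r ^ 2 = 1) (n : ℕ) : (legendrePoly n).eval r = r ^ n := by
  rw [legendrePoly, eval_mul, eval_C, eval_iterate_derivative_eq_factorial_mul_coeff_taylor,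
    taylor_sq_sub_one_pow hr, coeff_mul_X_pow', if_pos le_rfl, Nat.sub_self, coeff_X_add_C_pow]
  have : (n.factorial : ℂ) ≠ 0 := by exact_mod_cast n.factorial_ne_zero
  simp only [Nat.sub_zero, Nat.choose_zero_right, Nat.cast_one, mul_one, mul_pow]
  field_simp

theorem eval_derivative_legendrePoly {r : ℂ} (hr : r ^ 2 = 1) (n : ℕ) :
    (derivative (legendrePoly n)).eval r = n * (n + 1) / 2 * r ^ (n + 1) := by
  rw [legendrePoly, derivative_C_mul, ← Function.iterate_succ_apply' derivative, eval_mul, eval_C,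
    eval_iterate_derivative_eq_factorial_mul_coeff_taylor,
    taylor_sq_sub_one_pow hr, coeff_mul_X_pow', if_pos n.le_succ, Nat.succ_eq_add_one, Nat.add_sub_cancel_left,
    coeff_X_add_C_pow]
  have : (n.factorial : ℂ) ≠ 0 := by exact_mod_cast n.factorial_ne_zero
  cases n with
  | zero => simp
  | succ k =>
    rw [Nat.factorial_succ (k + 1)]
    simp only [Nat.add_sub_cancel, Nat.choose_one_right, mul_pow]
    push_cast
    field_simp
    linear_combination -(2 * (k : ℂ) + 4) * 2 ^ k * r ^ k * hr

/-- `legendrePoly n` is orthogonal to all polynomials of degree less than `n`. -/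
theorem polyIntegral_legendrePoly_mul {n : ℕ} {q : ℂ[X]} (hq : q.natDegree < n) :
    polyIntegral (legendrePoly n * q) = 0 := by
  have key : ∀ m ≤ n, ∀ q : ℂ[X], derivative^[m] q = 0 →
      polyIntegral (derivative^[m] ((X ^ 2 - 1) ^ n) * q) = 0 := by
    intro m
    induction m with
    | zero =>
      intro _ q hq
      rw [show q = 0 from hq, mul_zero, map_zero]
    | succ m ih =>
      intro hm q hq
      rw [Function.iterate_succ_apply', polyIntegral_derivative_mul,
        eval_iterate_derivative_sq_sub_one_pow_of_lt (by norm_num) hm,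
        eval_iterate_derivative_sq_sub_one_pow_of_lt (by norm_num) hm,
        ih (Nat.le_of_succ_le hm) _ (by rwa [← Function.iterate_succ_apply])]
      simp
  rw [legendrePoly, mul_assoc, ← smul_eq_C_mul, map_smul,
    key n le_rfl q (iterate_derivative_eq_zero hq), smul_zero]

theorem natDegree_legendrePoly_le (n : ℕ) : (legendrePoly n).natDegree ≤ n := by
  refine (natDegree_C_mul_le _ _).trans ((natDegree_iterate_derivative _ _).trans ?_)
  have h : ((X ^ 2 - 1 : ℂ[X]) ^ n).natDegree ≤ n * 2 :=
    natDegree_pow_le_of_le n (by compute_degree)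
  omega

theorem natDegree_derivative_derivative_le (p : ℂ[X]) :
    (derivative (derivative p)).natDegree ≤ p.natDegree - 2 :=
  natDegree_iterate_derivative p 2

theorem polyIntegral_legendrePoly_mul_derivative_derivative (k : ℕ) :
    polyIntegral (legendrePoly k * derivative (derivative (legendrePoly (k + 2)))) =
      2 * (2 * (k : ℂ) + 3) := by
  have h : polyIntegral (legendrePoly (k + 2) * derivative (derivative (legendrePoly k))) = 0 := by
    apply polyIntegral_legendrePoly_mul
    have h₁ := natDegree_derivative_derivative_le (legendrePoly k)
    have h₂ := natDegree_legendrePoly_le k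
    omega
  have hone : (1 : ℂ) ^ 2 = 1 := by norm_num
  have hneg : (-1 : ℂ) ^ 2 = 1 := by norm_num
  rw [polyIntegral_mul_derivative_derivative, h]
  simp only [eval_legendrePoly hone, eval_legendrePoly hneg, eval_derivative_legendrePoly hone,
    eval_derivative_legendrePoly hneg]
  have hsq : ((-1 : ℂ) ^ k) ^ 2 = 1 := by rw [← pow_mul, mul_comm, pow_mul, hneg, one_pow]
  push_cast
  simp only [one_pow, pow_succ (-1 : ℂ)]
  linear_combination (2 * (k : ℂ) + 3) * hsq

/-- The boundary-adapted combination of Legendre polynomials of degrees `p` and `p + 2`. -/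
noncomputable def adaptedPoly (b : ℕ → ℂ) (p : ℕ) : ℂ[X] :=
  legendrePoly p + C (b p) * legendrePoly (p + 2)

theorem natDegree_adaptedPoly_le (b : ℕ → ℂ) (p : ℕ) : (adaptedPoly b p).natDegree ≤ p + 2 :=
  natDegree_add_le_of_degree_le ((natDegree_legendrePoly_le p).trans (by omega))
    ((natDegree_C_mul_le _ _).trans (natDegree_legendrePoly_le (p + 2)))

theorem polyIntegral_adaptedPoly_mul {b : ℕ → ℂ} {n : ℕ} {q : ℂ[X]} (hq : q.natDegree < n) :
    polyIntegral (adaptedPoly b n * q) = 0 := by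
  rw [adaptedPoly, add_mul, mul_assoc, ← smul_eq_C_mul, map_add, map_smul,
    polyIntegral_legendrePoly_mul hq,
    polyIntegral_legendrePoly_mul (hq.trans (by omega : n < n + 2)), smul_zero, add_zero]

/-- The Robin boundary conditions satisfied by the adapted basis at the endpoints `r = ±1`. -/
theorem eval_derivative_adaptedPoly {κ : ℂ} {b : ℕ → ℂ} {p : ℕ}
    (hb : b p * (κ + ((p : ℂ) + 2) * ((p : ℂ) + 3) / 2) = -(κ + (p : ℂ) * ((p : ℂ) + 1) / 2))
    {r : ℂ} (hr : r ^ 2 = 1) :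
    (derivative (adaptedPoly b p)).eval r = -(κ * r * (adaptedPoly b p).eval r) := by
  simp only [adaptedPoly, derivative_add, derivative_C_mul, eval_add, eval_mul, eval_C,
    eval_legendrePoly hr, eval_derivative_legendrePoly hr]
  push_cast
  simp only [pow_add, hr]
  linear_combination r ^ p * r * hb

theorem polyIntegral_adaptedPoly_mul_derivative_derivative_of_gt (b : ℕ → ℂ) {j k : ℕ}
    (hkj : k < j) :
    polyIntegral (adaptedPoly b j * derivative (derivative (adaptedPoly b k))) = 0 := by
  apply polyIntegral_adaptedPoly_mul
  have h₁ := natDegree_derivative_derivative_le (adaptedPoly b k)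
  have h₂ := natDegree_adaptedPoly_le b k
  omega

theorem polyIntegral_adaptedPoly_mul_derivative_derivative_self (b : ℕ → ℂ) (k : ℕ) :
    polyIntegral (adaptedPoly b k * derivative (derivative (adaptedPoly b k))) =
      2 * (2 * (k : ℂ) + 3) * b k := by
  have hdeg := natDegree_derivative_derivative_le (adaptedPoly b k)
  have hdeg' := natDegree_adaptedPoly_le b k
  have hP : polyIntegral (legendrePoly k * derivative (derivative (legendrePoly k))) = 0 := by
    rcases k with _ | k
    · have h : (legendrePoly 0).natDegree < 1 :=
        (natDegree_legendrePoly_le 0).trans_lt Nat.zero_lt_one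
      rw [← Function.iterate_one derivative, iterate_derivative_eq_zero h]
      simp
    · apply polyIntegral_legendrePoly_mul
      have h₁ := natDegree_derivative_derivative_le (legendrePoly (k + 1))
      have h₂ := natDegree_legendrePoly_le (k + 1)
      omega
  have hQ : polyIntegral (legendrePoly (k + 2) * derivative (derivative (adaptedPoly b k))) = 0 :=
    polyIntegral_legendrePoly_mul (by omega)
  conv_lhs => enter [2, 1]; rw [adaptedPoly]
  rw [add_mul, mul_assoc, ← smul_eq_C_mul, map_add, map_smul, hQ, smul_zero, add_zero,
    adaptedPoly, derivative_add, derivative_add, derivative_C_mul, derivative_C_mul, mul_add,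
    mul_left_comm, ← smul_eq_C_mul, map_add, map_smul, hP,
    polyIntegral_legendrePoly_mul_derivative_derivative, smul_eq_mul]
  ring

/-- The stiffness matrix of the boundary-adapted Legendre basis is diagonal. -/
theorem stiffness_matrix_diagonal (κ : ℂ)
    (hκ : ∀ q : ℕ, κ + ((q:ℂ) + 2) * ((q:ℂ) + 3) / 2 ≠ 0)
    (b : ℕ → ℂ)
    (hb : ∀ p : ℕ, b p = -(κ + (p:ℂ) * ((p:ℂ) + 1) / 2) / (κ + ((p:ℂ) + 2) * ((p:ℂ) + 3) / 2))
    (φ : ℕ → ℝ → ℂ)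
    (hφ : ∀ (p : ℕ) (y : ℝ), φ p y = (legendreP p y : ℂ) + b p * (legendreP (p+2) y : ℂ)) :
    ∀ j k : ℕ,
      (j = k → ∫ y in (-1:ℝ)..1, φ j y * deriv (deriv (φ k)) y = 2 * (2 * (k:ℂ) + 3) * b k) ∧
      (j ≠ k → ∫ y in (-1:ℝ)..1, φ j y * deriv (deriv (φ k)) y = 0) := by
  have hφ' (p : ℕ) : φ p = fun y : ℝ => (adaptedPoly b p).eval (y : ℂ) := by
    ext y
    rw [hφ, ofReal_legendreP, ofReal_legendreP]
    simp [adaptedPoly]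
  have hderiv (p : ℂ[X]) :
      deriv (fun y : ℝ => p.eval (y : ℂ)) = fun y : ℝ => (derivative p).eval (y : ℂ) :=
    funext fun y => (hasDerivAt_polynomial_eval_ofReal p y).deriv
  have hint (j k : ℕ) : ∫ y in (-1:ℝ)..1, φ j y * deriv (deriv (φ k)) y =
      polyIntegral (adaptedPoly b j * derivative (derivative (adaptedPoly b k))) := by
    simp only [hφ', hderiv, polyIntegral, LinearMap.coe_mk, AddHom.coe_mk, eval_mul]
  have hbmul (p : ℕ) : b p * (κ + ((p : ℂ) + 2) * ((p : ℂ) + 3) / 2) =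
      -(κ + (p : ℂ) * ((p : ℂ) + 1) / 2) := by
    rw [hb p, div_mul_cancel₀ _ (hκ p)]
  intro j k
  rw [hint]
  refine ⟨?_, fun hjk => ?_⟩
  · rintro rfl
    exact polyIntegral_adaptedPoly_mul_derivative_derivative_self b j
  · rcases lt_or_gt_of_ne hjk with h | h
    · have hone : (1 : ℂ) ^ 2 = 1 := by norm_num
      have hneg : (-1 : ℂ) ^ 2 = 1 := by norm_num
      rw [polyIntegral_mul_derivative_derivative,
        polyIntegral_adaptedPoly_mul_derivative_derivative_of_gt b h,
        eval_derivative_adaptedPoly (hbmul j) hone, eval_derivative_adaptedPoly (hbmul k) hone,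
        eval_derivative_adaptedPoly (hbmul j) hneg, eval_derivative_adaptedPoly (hbmul k) hneg]
      ring
    · exact polyIntegral_adaptedPoly_mul_derivative_derivative_of_gt b h
end

section
/- Let (ω_j)_{j∈ℕ} be the rational sequence defined by ω₀ = 1, ω₁ = −1, and (j+1) ω_{j+1} = (j−1) ω_{j−1} − ω_j for j ≥ 1 (the trapezoidal-rule convolution quadrature weights for the half-order derivative). Then ω_{2n} = C_n and ω_{2n+1} = −C_n for all n ∈ ℕ, where C_n = (2n)! / (4ⁿ (n!)²) = (1·3·…·(2n−1)) / (n! 2ⁿ). -/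
/-- The numbers `C_n = (2n)!/(4ⁿ (n!)²)` satisfy `(2n+2) C_{n+1} = (2n+1) C_n`. -/
theorem two_mul_add_two_mul_factorial_div (n : ℕ) :
    (2 * (n : ℚ) + 2) *
        (((2 * (n + 1)).factorial : ℚ) / (4 ^ (n + 1) * ((n + 1).factorial : ℚ) ^ 2)) =
      (2 * (n : ℚ) + 1) * (((2 * n).factorial : ℚ) / (4 ^ n * (n.factorial : ℚ) ^ 2)) := by
  have hn : (n.factorial : ℚ) ≠ 0 := by positivity
  have hn1 : (n : ℚ) + 1 ≠ 0 := by positivity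
  rw [show 2 * (n + 1) = 2 * n + 1 + 1 by ring]
  simp only [Nat.factorial_succ]
  push_cast
  field_simp
  ring

/-- Closed form of the trapezoidal-rule convolution-quadrature weights for the
half-order derivative: `ω_{2n} = C_n` and `ω_{2n+1} = -C_n` with
`C_n = (2n)!/(4ⁿ (n!)²)`. -/
theorem tr_cq_weights_closed_form (ω : ℕ → ℚ)
    (h0 : ω 0 = 1) (h1 : ω 1 = -1)
    (hrec : ∀ j : ℕ, 1 ≤ j →
      ((j:ℚ) + 1) * ω (j + 1) = ((j:ℚ) - 1) * ω (j - 1) - ω j) :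
    ∀ n : ℕ,
      ω (2 * n) = ((2 * n).factorial : ℚ) / (4^n * ((n.factorial : ℚ))^2) ∧
      ω (2 * n + 1) = -(((2 * n).factorial : ℚ) / (4^n * ((n.factorial : ℚ))^2)) := by
  intro n
  induction n with
  | zero => simp [h0, h1]
  | succ n ih =>
    obtain ⟨heven, hodd⟩ := ih
    have hC := two_mul_add_two_mul_factorial_div n
    set C := ((2 * n).factorial : ℚ) / (4 ^ n * (n.factorial : ℚ) ^ 2)
    set C' := ((2 * (n + 1)).factorial : ℚ) / (4 ^ (n + 1) * ((n + 1).factorial : ℚ) ^ 2)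
    have heven' : ω (2 * (n + 1)) = C' := by
      have h := hrec (2 * n + 1) (by lia)
      rw [Nat.add_sub_cancel, heven, hodd] at h
      push_cast at h
      refine mul_left_cancel₀ (show 2 * (n : ℚ) + 2 ≠ 0 by positivity) ?_
      rw [show 2 * (n + 1) = 2 * n + 1 + 1 by ring]
      linear_combination h - hC
    refine ⟨heven', ?_⟩
    have h := hrec (2 * (n + 1)) (by lia)
    rw [show 2 * (n + 1) - 1 = 2 * n + 1 by lia, heven', hodd] at h
    push_cast at h
    refine mul_left_cancel₀ (show 2 * (n : ℚ) + 3 ≠ 0 by positivity) ?_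
    linear_combination h + hC
end

section
/- Define the physicists' Hermite polynomials by H₀(x) = 1, H₁(x) = 2x, H_{n+1}(x) = 2x H_n(x) − 2n H_{n−1}(x). Let a > 0 and m ∈ ℕ, and define w(t) = √(1 + (4at)²), μ(t) = (1/a + 4it)^{−1}, θ(t) = arctan(4at), γ_m² = 2^m m! √π (2a)^{−1/2}, and the Hermite-Gaussian function G_m(x,t) = γ_m^{−1} H_m( √(2a) x / w(t) ) · √(μ(t)/a) · exp( −μ(t) x² − i m θ(t) ), where √(μ(t)/a) is the principal square root. Then G_m is an exact solution of the free one-dimensional Schrödinger equation: i∂_t G_m + ∂²_x G_m = 0 for all (x,t) ∈ ℝ × ℝ. -/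
open MeasureTheory Real

/-- The physicists' Hermite polynomials, via the three-term recurrence
`H₀ = 1`, `H₁ = 2x`, `H_{n+1} = 2x H_n − 2n H_{n−1}`. -/
noncomputable def physHermite : ℕ → ℝ → ℝ
  | 0, _ => 1
  | 1, x => 2 * x
  | (n + 2), x => 2 * x * physHermite (n + 1) x - 2 * (n + 1) * physHermite n x

theorem physHermite_add_two (n : ℕ) (y : ℝ) :
    physHermite (n + 2) y = 2 * y * physHermite (n + 1) y - 2 * (n + 1) * physHermite n y := by
  rw [physHermite]

theorem hasDerivAt_physHermite (n : ℕ) (y : ℝ) :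
    HasDerivAt (physHermite n) (2 * y * physHermite n y - physHermite (n + 1) y) y := by
  induction n using Nat.twoStepInduction with
  | zero =>
    have h : physHermite 0 = fun _ => 1 := by funext z; rw [physHermite]
    have h' : physHermite 1 = fun z => 2 * z := by funext z; rw [physHermite]
    simpa [h, h'] using hasDerivAt_const y (1 : ℝ)
  | one =>
    have h : physHermite 0 = fun _ => 1 := by funext z; rw [physHermite]
    have h' : physHermite 1 = fun z => 2 * z := by funext z; rw [physHermite]
    rw [physHermite_add_two 0, h, h']
    refine HasDerivAt.congr_deriv ((hasDerivAt_id' y).const_mul 2) ?_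
    push_cast
    ring
  | more n ih₀ ih₁ =>
    have h : physHermite (n + 2) = fun z =>
        2 * z * physHermite (n + 1) z - 2 * (n + 1) * physHermite n z :=
      funext (physHermite_add_two n)
    rw [physHermite_add_two (n + 1), h]
    refine HasDerivAt.congr_deriv ((((hasDerivAt_id' y).const_mul 2).fun_mul ih₁).fun_sub
      (ih₀.const_mul (2 * (n + 1 : ℝ)))) ?_
    simp only [physHermite_add_two]
    push_cast
    ring

/-- The Hermite differential equation for `Hₙ`, whose derivative is `2 y Hₙ - Hₙ₊₁`. -/
theorem hasDerivAt_deriv_physHermite (n : ℕ) (y : ℝ) :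
    HasDerivAt (fun z => 2 * z * physHermite n z - physHermite (n + 1) z)
      (2 * y * (2 * y * physHermite n y - physHermite (n + 1) y) - 2 * n * physHermite n y) y := by
  refine HasDerivAt.congr_deriv ((((hasDerivAt_id' y).const_mul 2).fun_mul
    (hasDerivAt_physHermite n y)).fun_sub (hasDerivAt_physHermite (n + 1) y)) ?_
  simp only [physHermite_add_two]
  ring

theorem one_div_add_four_I_mul_ne_zero {a : ℝ} (ha : 0 < a) (t : ℝ) :
    1 / (a : ℂ) + 4 * Complex.I * t ≠ 0 := by
  intro h
  have := congrArg Complex.re h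
  simp [← Complex.ofReal_inv] at this
  exact ha.ne' this

theorem hasDerivAt_inv_one_div_add_four_I_mul {a : ℝ} (ha : 0 < a) (t : ℝ) :
    HasDerivAt (fun s : ℝ => (1 / (a : ℂ) + 4 * Complex.I * s)⁻¹)
      (-4 * Complex.I * ((1 / (a : ℂ) + 4 * Complex.I * t)⁻¹) ^ 2) t := by
  have hne := one_div_add_four_I_mul_ne_zero ha t
  have h := (((hasDerivAt_id' t).ofReal_comp.const_mul (4 * Complex.I)).const_add
    (1 / (a : ℂ))).inv hne
  refine h.congr_deriv ?_
  simp only [inv_pow, Complex.ofReal_one]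
  ring

theorem hasDerivAt_sqrt_inv_one_div_add_four_I_mul {a : ℝ} (ha : 0 < a) (t : ℝ) :
    HasDerivAt (fun s : ℝ => ((1 / (a : ℂ) + 4 * Complex.I * s)⁻¹ / a) ^ (1 / 2 : ℂ))
      (-2 * Complex.I * (1 / (a : ℂ) + 4 * Complex.I * t)⁻¹ *
        ((1 / (a : ℂ) + 4 * Complex.I * t)⁻¹ / a) ^ (1 / 2 : ℂ)) t := by
  have hne := one_div_add_four_I_mul_ne_zero ha t
  have haC : (a : ℂ) ≠ 0 := by exact_mod_cast ha.ne'
  have hslit : (1 / (a : ℂ) + 4 * Complex.I * t)⁻¹ / a ∈ Complex.slitPlane := by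
    left
    rw [Complex.div_ofReal_re, Complex.inv_re]
    refine div_pos (div_pos ?_ (Complex.normSq_pos.2 hne)) ha
    simpa [← Complex.ofReal_inv] using ha
  have h := ((hasDerivAt_id' _).cpow_const (c := (1 / 2 : ℂ)) hslit).comp t
    ((hasDerivAt_inv_one_div_add_four_I_mul ha t).div_const (a : ℂ))
  refine h.congr_deriv ?_
  rw [Complex.cpow_sub _ _ (Complex.slitPlane_ne_zero hslit), Complex.cpow_one]
  field_simp
  ring

theorem hasDerivAt_sqrt_one_add_sq (a t : ℝ) :
    HasDerivAt (fun s : ℝ => √(1 + (4 * a * s) ^ 2))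
      (16 * a ^ 2 * t / √(1 + (4 * a * t) ^ 2)) t := by
  have h := ((((hasDerivAt_id' t).const_mul (4 * a)).fun_pow 2).const_add 1).sqrt
    (by positivity)
  refine h.congr_deriv ?_
  have : √(1 + (4 * a * t) ^ 2) ≠ 0 := by positivity
  field_simp
  ring

/-- The Hermite-Gaussian function is an exact solution of the free
one-dimensional Schrödinger equation `i∂_t G + ∂²_x G = 0`. -/
theorem hermite_gaussian_solves_schrodinger_1d
    (a : ℝ) (ha : 0 < a) (m : ℕ)
    (w : ℝ → ℝ) (hw : ∀ t : ℝ, w t = Real.sqrt (1 + (4 * a * t)^2))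
    (μ : ℝ → ℂ) (hμ : ∀ t : ℝ, μ t = (1 / (a:ℂ) + 4 * Complex.I * t)⁻¹)
    (θ : ℝ → ℝ) (hθ : ∀ t : ℝ, θ t = Real.arctan (4 * a * t))
    (γ : ℝ) (hγpos : 0 < γ)
    (hγ : γ^2 = 2^m * m.factorial * Real.sqrt π * (2 * a) ^ (-(1/2) : ℝ))
    (G : ℝ → ℝ → ℂ)
    (hG : ∀ x t : ℝ, G x t =
      (γ:ℂ)⁻¹ * (physHermite m (Real.sqrt (2 * a) * x / w t) : ℂ) *
        (μ t / (a:ℂ)) ^ (1/2 : ℂ) *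
        Complex.exp (-(μ t) * x^2 - Complex.I * m * θ t)) :
    ∀ x t : ℝ,
      Complex.I * deriv (fun t' => G x t') t + deriv (deriv (fun x' => G x' t)) x = 0 := by
  intro x t
  set H : ℝ → ℝ := physHermite m with hH
  set H₁ : ℝ → ℝ := fun z => 2 * z * physHermite m z - physHermite (m + 1) z with hH₁
  have dH : ∀ y, HasDerivAt H (H₁ y) y := hasDerivAt_physHermite m
  have dH₁ : ∀ y, HasDerivAt H₁ (2 * y * H₁ y - 2 * m * H y) y := hasDerivAt_deriv_physHermite m
  clear_value H H₁
  set s := √(2 * a) with hs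
  have hs2 : s ^ 2 = 2 * a := Real.sq_sqrt (by positivity)
  have hwpos : 0 < w t := by rw [hw]; positivity
  have hw2 : w t ^ 2 = 1 + (4 * a * t) ^ 2 := by rw [hw]; exact Real.sq_sqrt (by positivity)
  have hμw : μ t * w t ^ 2 = a * (1 - 4 * Complex.I * a * t) := by
    have hne := one_div_add_four_I_mul_ne_zero ha t
    have haC : (a : ℂ) ≠ 0 := by exact_mod_cast ha.ne'
    have hw2C : (w t : ℂ) ^ 2 = 1 + (4 * a * t) ^ 2 := by exact_mod_cast hw2
    rw [hμ, hw2C, inv_mul_eq_iff_eq_mul₀ hne]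
    field_simp
    linear_combination ((16 * (a : ℂ) ^ 2 * t ^ 2)) * Complex.I_sq
  have dw : HasDerivAt w (16 * a ^ 2 * t / w t) t := by
    rw [hw, funext hw]; exact hasDerivAt_sqrt_one_add_sq a t
  have dμ : HasDerivAt μ (-4 * Complex.I * μ t ^ 2) t := by
    rw [hμ, funext hμ]; exact hasDerivAt_inv_one_div_add_four_I_mul ha t
  have dg : HasDerivAt (fun r => (μ r / (a : ℂ)) ^ (1 / 2 : ℂ))
      (-2 * Complex.I * μ t * (μ t / a) ^ (1 / 2 : ℂ)) t := by
    simp only [hμ]; exact hasDerivAt_sqrt_inv_one_div_add_four_I_mul ha t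
  have dθ : HasDerivAt θ (4 * a / w t ^ 2) t := by
    rw [hw2, funext hθ]
    refine HasDerivAt.congr_deriv (((hasDerivAt_id' t).const_mul (4 * a)).arctan) ?_
    ring
  set c := (γ : ℂ)⁻¹
  set E : ℝ → ℂ := fun z => Complex.exp (-(μ t) * z ^ 2 - Complex.I * m * θ t) with hE
  set g := (μ t / (a : ℂ)) ^ (1 / 2 : ℂ) with hg
  have dt : HasDerivAt (fun r => G x r)
      (c * E x * g * ((H (s * x / w t) : ℂ) *
          (-2 * Complex.I * μ t + 4 * Complex.I * μ t ^ 2 * x ^ 2 -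
            4 * Complex.I * m * a / w t ^ 2) -
        H₁ (s * x / w t) * (16 * s * x * a ^ 2 * t / w t ^ 3))) t := by
    simp only [hG]
    refine HasDerivAt.congr_deriv
      ((((((dH _).comp t ((hasDerivAt_const t (s * x)).fun_div dw hwpos.ne')).ofReal_comp.const_mul
        c).fun_mul dg).fun_mul ((dμ.fun_neg.mul_const ((x : ℂ) ^ 2)).fun_sub
          (dθ.ofReal_comp.const_mul (Complex.I * m))).cexp)) ?_
    simp only [Function.comp_apply, ← hg, hE]
    push_cast
    ring
  have dy : ∀ z : ℝ, HasDerivAt (fun z => s * z / w t) (s / w t) z := fun z => by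
    simpa using ((hasDerivAt_id' z).const_mul s).div_const (w t)
  have dE : ∀ z : ℝ, HasDerivAt E (E z * (-(2 * μ t * z))) z := fun z => by
    refine HasDerivAt.congr_deriv ((((hasDerivAt_id' z).ofReal_comp.fun_pow 2).const_mul
      (-(μ t))).sub_const (Complex.I * m * θ t)).cexp ?_
    simp only [Complex.ofReal_one, hE]
    push_cast
    ring
  have dx : ∀ z : ℝ, HasDerivAt (fun z => G z t)
      (c * g * (E z * ((H₁ (s * z / w t) : ℂ) * (s / w t) -
        H (s * z / w t) * (2 * μ t * z)))) z := fun z => by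
    simp only [hG]
    refine HasDerivAt.congr_deriv
      (((((dH _).comp z (dy z)).ofReal_comp.const_mul c).mul_const g).fun_mul (dE z)) ?_
    simp only [Function.comp_apply]
    push_cast
    ring
  have dxx := ((dE x).fun_mul ((((dH₁ _).comp x (dy x)).ofReal_comp.mul_const
    ((s : ℂ) / w t)).fun_sub (((dH _).comp x (dy x)).ofReal_comp.fun_mul
      ((hasDerivAt_id' x).ofReal_comp.const_mul (2 * μ t))))).const_mul (c * g)
  simp only [Function.comp_apply] at dxx
  rw [dt.deriv, funext fun z => (dx z).deriv, dxx.deriv]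
  have hwC : (w t : ℂ) ≠ 0 := by exact_mod_cast hwpos.ne'
  have hs2C : (s : ℂ) ^ 2 = 2 * a := by exact_mod_cast hs2
  have hμ' : μ t = a * (1 - 4 * Complex.I * a * t) / w t ^ 2 := by
    rw [eq_div_iff (pow_ne_zero 2 hwC), hμw]
  push_cast
  linear_combination c * g * E x * (
    (H (s * x / w t) * (-2 * μ t + 4 * μ t ^ 2 * x ^ 2 - 4 * m * a / w t ^ 2)) * Complex.I_sq +
    (2 * s * x / w t ^ 3 * H₁ (s * x / w t) - 2 * m / w t ^ 2 * H (s * x / w t)) * hs2C -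
    4 * x * s / w t * H₁ (s * x / w t) * hμ')
end
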